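/- For any complex number z, the following identity of formal power series in x holds: (∏_{k≥1} (1-x^{2k})^{z+1}/(1-x^k))^{2z-1} = Σ_{λ ∈ SC} δ_λ x^{|λ|} ∏_{h ∈ H(λ)} (1 - 2z/(h ε_h)), where the sum ranges over all self-conjugate partitions λ. -/

import Mathlib

/-!
Statement 0 (Theorem 1.1, type C̃ˇ Nekrasov–Okounkov formula):
for any complex number `z`,
(∏_{k≥1} (1-x^{2k})^{z+1}/(1-x^k))^{2z-1}
  = Σ_{λ ∈ SC} δ_λ x^{|λ|} ∏_{h ∈ H(λ)} (1 - 2z/(h ε_h)),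
as formal power series over ℂ, the sum ranging over self-conjugate partitions.
Complex powers `(1-u)^z` are interpreted via the binomial series
Σ_k binom(z,k) (-u)^k, i.e. `cpow f z = Σ_k binom(z,k) (f-1)^k`.
-/

noncomputable section

open PowerSeries

/-- Product (pi) topology on formal power series, i.e. the topology of
coefficientwise convergence. -/
instance {R : Type*} [TopologicalSpace R] : TopologicalSpace (PowerSeries R) :=
  inferInstanceAs (TopologicalSpace ((Unit →₀ ℕ) → R))

/-- The hook length of the box `c = (i, j)` (0-indexed) of a Young diagram. -/
def hookLen (μ : YoungDiagram) (c : ℕ × ℕ) : ℕ :=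
  μ.rowLen c.1 + μ.colLen c.2 - c.1 - c.2 - 1

/-- The Durfee length: the number of diagonal cells. -/
def durfee (μ : YoungDiagram) : ℕ :=
  (μ.cells.filter fun c => c.1 = c.2).card

/-- `ε` of a box: `-1` if strictly above the principal diagonal (row index > column
index), `1` otherwise. -/
def eps (c : ℕ × ℕ) : ℂ := if c.2 < c.1 then (-1 : ℂ) else 1

/-- Generalized binomial coefficient `binom(z, k) = z(z-1)⋯(z-k+1)/k!`. -/
def cchoose (z : ℂ) (k : ℕ) : ℂ := (∏ i ∈ Finset.range k, (z - i)) / (k.factorial : ℂ)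

/-- The complex power `f^z = Σ_k binom(z,k) (f-1)^k` of a power series with
constant coefficient `1`; this is `exp (z log f)`. -/
def cpow (f : PowerSeries ℂ) (z : ℂ) : PowerSeries ℂ :=
  ∑' k : ℕ, PowerSeries.C (cchoose z k) * (f - 1) ^ k

set_option linter.unusedSimpArgs false
section ML
variable {K : Type*} [CommRing K]

/-- Entry above (zero outside the array). -/
def arrPa (N : ℕ → ℕ → K) : ℕ → ℕ → K
  | 0, _ => 0
  | a + 1, b => N a b

/-- Entry to the left (zero outside the array). -/
def arrPb (N : ℕ → ℕ → K) : ℕ → ℕ → K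
  | _, 0 => 0
  | a, b + 1 => N a b

/-- Indicator of the corner. -/
def arrD (a b : ℕ) : K := if a = 0 ∧ b = 0 then 1 else 0

/-- Action of multiplication by `1 - u t` on an array. -/
def shiftArr (u : K) (N : ℕ → ℕ → K) : ℕ → ℕ → K
  | a, 0 => N a 0 - u * arrPa N a 0 - u * arrD a 0
  | a, b + 1 => u * shiftArr u N a b + N a (b + 1) - u * arrPa N a (b + 1)

/-- The quadratic relation. -/
def Riccati (N : ℕ → ℕ → K) : Prop :=
  ∀ a b, arrPa N a b + N (a + 1) b - arrPb N a b - N a (b + 1) + arrD a b = N a 0 * N 0 b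

lemma shiftArr_spec (u : K) (N : ℕ → ℕ → K) (a b : ℕ) :
    shiftArr u N a b - u * arrPb (shiftArr u N) a b = N a b - u * arrPa N a b - u * arrD a b := by
  cases b with
  | zero => simp [shiftArr, arrPb]
  | succ b => simp [shiftArr, arrPb, arrD]; ring

lemma shiftArr_zero (N : ℕ → ℕ → K) : shiftArr 0 N = N := by
  funext a b
  cases b <;> simp [shiftArr]

lemma shiftArr_unique (u : K) (N M : ℕ → ℕ → K)
    (h : ∀ a b, M a b - u * arrPb M a b = N a b - u * arrPa N a b - u * arrD a b) :
    M = shiftArr u N := by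
  funext a b
  induction b with
  | zero => simpa [shiftArr, arrPb] using h a 0
  | succ b ih =>
    have := h a (b + 1)
    simp only [arrPb, arrD] at this
    simp only [shiftArr, ← ih]
    simp at this
    linear_combination this

lemma shiftArr_key (v : K) (N : ℕ → ℕ → K) (hN : Riccati N) (a b : ℕ) :
    N a b - v * N a (b + 1) =
      shiftArr v N a b - v * shiftArr v N (a + 1) b + v * N a 0 * shiftArr v N 0 b := by
  induction b with
  | zero =>
    have h := hN a 0
    cases a <;> simp [shiftArr, arrPa, arrD, arrPb] at h ⊢ <;> linear_combination v * h
  | succ b ih =>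
    have h := hN a (b + 1)
    cases a <;> simp [shiftArr, arrPa, arrD, arrPb] at h ih ⊢ <;>
      linear_combination v * h + v * ih

variable {n : ℕ}

/-- Truncated matrix of an array. -/
def mat (n : ℕ) (F : ℕ → ℕ → K) : Matrix (Fin n) (Fin n) K := Matrix.of fun a b => F a b

/-- Shift matrix. -/
def shS (K : Type*) [CommRing K] (n : ℕ) : Matrix (Fin n) (Fin n) K :=
  mat n fun a b => if a = b + 1 then 1 else 0

/-- Transposed shift matrix. -/
def shR (K : Type*) [CommRing K] (n : ℕ) : Matrix (Fin n) (Fin n) K :=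
  mat n fun a b => if b = a + 1 then 1 else 0

lemma mat_mul_S (F : ℕ → ℕ → K) (h : ∀ a, F a n = 0) :
    mat n F * shS K n = mat n fun a b => F a (b + 1) := by
  ext a b
  simp only [Matrix.mul_apply, mat, shS, Matrix.of_apply, mul_ite, mul_one, mul_zero]
  by_cases hb : (b : ℕ) + 1 < n
  · rw [Finset.sum_eq_single (⟨b + 1, hb⟩ : Fin n)]
    · simp
    · intro k _ hk
      rw [if_neg]; intro h'; apply hk; ext; exact h'
    · simp
  · have hb' : (b : ℕ) + 1 = n := by have := b.2; omega
    rw [hb', h, Finset.sum_eq_zero]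
    intro k _
    rw [if_neg]; have := k.2; omega

lemma mat_mul_R (F : ℕ → ℕ → K) :
    mat n F * shR K n = mat n (arrPb F) := by
  ext a b
  simp only [Matrix.mul_apply, mat, shR, Matrix.of_apply, mul_ite, mul_one, mul_zero]
  obtain ⟨b, hb⟩ := b
  cases b with
  | zero => simp [arrPb]
  | succ b =>
    rw [Finset.sum_eq_single (⟨b, by omega⟩ : Fin n)]
    · simp [arrPb]
    · intro k _ hk
      rw [if_neg]; intro h'; apply hk; ext; simp at h' ⊢; omega
    · simp

lemma S_mul_mat (F : ℕ → ℕ → K) :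
    shS K n * mat n F = mat n (arrPa F) := by
  ext a b
  simp only [Matrix.mul_apply, mat, shS, Matrix.of_apply, ite_mul, one_mul, zero_mul]
  obtain ⟨a, ha⟩ := a
  cases a with
  | zero => simp [arrPa]
  | succ a =>
    rw [Finset.sum_eq_single (⟨a, by omega⟩ : Fin n)]
    · simp [arrPa]
    · intro k _ hk
      rw [if_neg]; intro h'; apply hk; ext; simp at h' ⊢; omega
    · simp

lemma R_mul_mat (F : ℕ → ℕ → K) (h : ∀ b, F n b = 0) :
    shR K n * mat n F = mat n fun a b => F (a + 1) b := by
  ext a b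
  simp only [Matrix.mul_apply, mat, shR, Matrix.of_apply, ite_mul, one_mul, zero_mul]
  by_cases hb : (a : ℕ) + 1 < n
  · rw [Finset.sum_eq_single (⟨a + 1, hb⟩ : Fin n)]
    · simp
    · intro k _ hk
      rw [if_neg]; intro h'; apply hk; ext; exact h'
    · simp
  · have hb' : (a : ℕ) + 1 = n := by have := a.2; omega
    rw [hb', h, Finset.sum_eq_zero]
    intro k _
    rw [if_neg]; have := k.2; omega

lemma mat_mul_E (F : ℕ → ℕ → K) :
    mat n F * mat n arrD = mat n fun a b => F a 0 * arrD 0 b := by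
  ext a b
  simp only [Matrix.mul_apply, mat, Matrix.of_apply]
  have hn : 0 < n := by have := a.2; omega
  rw [Finset.sum_eq_single (⟨0, hn⟩ : Fin n)]
  · intro k _ hk
    have : (k : ℕ) ≠ 0 := fun h => hk (by ext; exact h)
    simp [arrD, this]
  · simp

lemma E_mul_mat (F : ℕ → ℕ → K) :
    mat n arrD * mat n F = mat n fun a b => arrD a 0 * F 0 b := by
  ext a b
  simp only [Matrix.mul_apply, mat, Matrix.of_apply]
  have hn : 0 < n := by have := a.2; omega
  rw [Finset.sum_eq_single (⟨0, hn⟩ : Fin n)]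
  · intro k _ hk
    have : (k : ℕ) ≠ 0 := fun h => hk (by ext; exact h)
    simp [arrD, this]
  · simp

lemma one_eq_mat : (1 : Matrix (Fin n) (Fin n) K) = mat n fun a b => if a = b then 1 else 0 := by
  ext a b
  simp [mat, Matrix.one_apply, Fin.ext_iff]

lemma det_one_sub_S (w : K) : (1 - w • shS K n).det = 1 := by
  rw [Matrix.det_of_isLowerTriangular]
  · apply Finset.prod_eq_one
    intro i _
    simp [shS, mat]
  · intro i j hij
    simp only [OrderDual.toDual_lt_toDual] at hij
    have : (i : ℕ) < j := hij
    simp [shS, mat, Matrix.one_apply, Fin.ext_iff, this.ne]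
    intro h; omega

lemma det_one_sub_R (w : K) : (1 - w • shR K n).det = 1 := by
  have : shR K n = (shS K n).transpose := by
    ext a b; simp [shR, shS, mat]
  rw [← det_one_sub_S (n := n) w, ← Matrix.det_transpose, this]
  simp

/-- The matrix `1 - (x^(a+b+1) N a b)`. -/
def gz (n : ℕ) (x : K) (N : ℕ → ℕ → K) : K := (1 - mat n fun a b => x ^ (a + b + 1) * N a b).det

/-- Claim (a). -/
lemma claimA (x u : K) (hx : x ^ n = 0) (N : ℕ → ℕ → K) :
    (1 - mat n fun a b => x ^ (a + b + 1) * shiftArr u N a b) *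
      ((1 + (u * x) ^ 2) • (1 : Matrix (Fin n) (Fin n) K) - (u * x) • shS K n - (u * x) • shR K n
        - (u * x) • mat n arrD) =
    (1 - (u * x) • shS K n) * (1 - (u * x) • shR K n
      - (mat n fun a b => x ^ (a + b + 1) * N a b)
      + (u * x) • ((mat n fun a b => x ^ (a + b + 1) * N a b) * shS K n)
      + (u * x) • ((mat n fun a b => x ^ (a + b + 1) * N a b) * mat n arrD)) := by
  have hz : ∀ k, x ^ (n + k) = 0 := fun k => by rw [pow_add, hx, zero_mul]
  have h1 : ∀ (M : ℕ → ℕ → K) a, x ^ (a + n + 1) * M a n = 0 := fun M a => by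
    rw [show a + n + 1 = n + (a + 1) by ring, hz, zero_mul]
  have hSR : shS K n * shR K n = 1 - mat n arrD := by
    rw [shR, S_mul_mat, one_eq_mat]
    ext a b
    obtain ⟨a, ha⟩ := a
    obtain ⟨b, hb⟩ := b
    cases a <;> cases b <;> simp [mat, arrPa, arrD, eq_comm]
  simp only [sub_mul, mul_sub, mul_add, one_mul, mul_one, smul_mul_assoc, mul_smul_comm, hSR]
  rw [mat_mul_S _ (h1 _), mat_mul_S _ (h1 _), mat_mul_R, mat_mul_E, mat_mul_E, S_mul_mat,
    S_mul_mat, S_mul_mat, one_eq_mat]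
  ext a b
  obtain ⟨a, ha⟩ := a
  obtain ⟨b, hb⟩ := b
  simp only [Matrix.sub_apply, Matrix.add_apply, Matrix.smul_apply, mat, shS, shR, Matrix.of_apply,
    smul_eq_mul]
  have e1 := shiftArr_spec u N a b
  have e2 := shiftArr_spec u N a (b + 1)
  rcases a with _ | a <;> rcases b with _ | b <;> simp only [arrPa, arrPb, arrD] at e1 e2 ⊢ <;>
    simp at e1 e2 ⊢
  · linear_combination (-(x - u * x * x)) * e1 + (u * x * x ^ 2) * e2
  · split_ifs <;>
    linear_combination (-(x ^ (b + 2))) * e1 + (u * x * x ^ (b + 3)) * e2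
  · split_ifs <;>
    linear_combination (-(x ^ (a + 2) - u * x * x ^ (a + 2))) * e1 + (u * x * x ^ (a + 3)) * e2
  · split_ifs <;>
    linear_combination (-(x ^ (a + b + 3))) * e1 + (u * x * x ^ (a + b + 4)) * e2

/-- Claim (b). -/
lemma claimB (x u : K) (hx : x ^ n = 0) (N : ℕ → ℕ → K) (hN : Riccati N) :
    1 - (u * x) • shR K n
      - (mat n fun a b => x ^ (a + b + 1) * N a b)
      + (u * x) • ((mat n fun a b => x ^ (a + b + 1) * N a b) * shS K n)
      + (u * x) • ((mat n fun a b => x ^ (a + b + 1) * N a b) * mat n arrD) =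
    (1 - (u * x) • shR K n
      + (u * x) • ((mat n fun a b => x ^ (a + b + 1) * N a b) * mat n arrD)) *
    (1 - mat n fun a b => x ^ (a + b + 1) * shiftArr (u * x ^ 2) N a b) := by
  have hz : ∀ k, x ^ (n + k) = 0 := fun k => by rw [pow_add, hx, zero_mul]
  have h1 : ∀ (M : ℕ → ℕ → K) a, x ^ (a + n + 1) * M a n = 0 := fun M a => by
    rw [show a + n + 1 = n + (a + 1) by ring, hz, zero_mul]
  have h2 : ∀ (M : ℕ → ℕ → K) b, x ^ (n + b + 1) * M n b = 0 := fun M b => by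
    rw [show n + b + 1 = n + (b + 1) by ring, hz, zero_mul]
  simp only [add_mul, sub_mul, mul_sub, mul_add, one_mul, mul_one, smul_mul_assoc,
    mul_assoc]
  rw [mat_mul_S _ (h1 _), R_mul_mat _ (h2 _), E_mul_mat]
  have h3 : (mat n fun a b => x ^ (a + b + 1) * N a b) *
      (mat n fun a b => arrD a 0 * (x ^ (0 + b + 1) * shiftArr (u * x ^ 2) N 0 b)) =
      mat n fun a b => (x ^ (a + 1) * N a 0) * (x ^ (b + 1) * shiftArr (u * x ^ 2) N 0 b) := by
    ext a b
    simp only [Matrix.mul_apply, mat, Matrix.of_apply]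
    have hn : 0 < n := by have := a.2; omega
    rw [Finset.sum_eq_single (⟨0, hn⟩ : Fin n)]
    · simp [arrD]
    · intro k _ hk
      have : (k : ℕ) ≠ 0 := fun h => hk (by ext; exact h)
      simp [arrD, this]
    · simp
  rw [h3]
  ext a b
  simp only [Matrix.sub_apply, Matrix.add_apply, Matrix.smul_apply, mat, shS, shR, Matrix.of_apply,
    smul_eq_mul]
  linear_combination (-x ^ ((a : ℕ) + b + 1)) * shiftArr_key (u * x ^ 2) N hN a b

lemma S_mulVec (w : K) (hw : w ^ n = 0) (hn : 0 < n) :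
    (1 - w • shS K n).mulVec (fun a : Fin n => w ^ (a : ℕ)) = Pi.single ⟨0, hn⟩ 1 := by
  ext ⟨a, ha⟩
  rw [Matrix.sub_mulVec, Matrix.one_mulVec, Matrix.smul_mulVec]
  simp only [Pi.sub_apply,
    Pi.smul_apply, smul_eq_mul, Matrix.mulVec, dotProduct, shS, mat, Matrix.of_apply, ite_mul,
    one_mul, zero_mul]
  rcases a with _ | a
  · simp
  · rw [Finset.sum_eq_single (⟨a, by omega⟩ : Fin n)]
    · simp [Pi.single_apply, pow_succ, mul_comm]
    · intro k _ hk
      rw [if_neg]; intro h'; apply hk; ext; simp at h' ⊢; omega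
    · simp

lemma R_vecMul (w : K) (hw : w ^ n = 0) (hn : 0 < n) :
    Matrix.vecMul (fun a : Fin n => w ^ (a : ℕ)) (1 - w • shR K n) = Pi.single ⟨0, hn⟩ 1 := by
  have : (1 - w • shR K n) = (1 - w • shS K n).transpose := by
    ext a b; simp [shR, shS, mat, Matrix.one_apply, eq_comm]
  rw [this, Matrix.vecMul_transpose, S_mulVec w hw hn]

open Matrix in
lemma det_calK (w : K) (hw : w ^ n = 0) (hn : 0 < n) :
    (1 + w) * ((1 + w ^ 2) • (1 : Matrix (Fin n) (Fin n) K) - w • shS K n - w • shR K n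
        - w • mat n arrD).det = 1 := by
  have hSR : shS K n * shR K n = 1 - mat n arrD := by
    rw [shR, S_mul_mat, one_eq_mat]
    ext a b
    obtain ⟨a, ha⟩ := a
    obtain ⟨b, hb⟩ := b
    cases a <;> cases b <;> simp [mat, arrPa, arrD, eq_comm]
  have hE : mat n arrD = Matrix.vecMulVec (Pi.single ⟨0, hn⟩ (1 : K)) (Pi.single ⟨0, hn⟩ 1) := by
    ext ⟨a, ha⟩ ⟨b, hb⟩
    by_cases h1 : a = 0 <;> by_cases h2 : b = 0 <;>
      simp [mat, arrD, Matrix.vecMulVec_apply, Pi.single_apply, h1, h2]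
  set f : Fin n → K := fun a => w ^ (a : ℕ) with hf
  have key : (1 + w ^ 2) • (1 : Matrix (Fin n) (Fin n) K) - w • shS K n - w • shR K n
        - w • mat n arrD = (1 - w • shS K n) *
          (1 + Matrix.vecMulVec ((w ^ 2 - w) • f) f) * (1 - w • shR K n) := by
    rw [Matrix.mul_add, Matrix.add_mul, mul_one, Matrix.mul_vecMulVec, Matrix.vecMulVec_mul,
      R_vecMul w hw hn, Matrix.mulVec_smul, S_mulVec w hw hn, Matrix.smul_vecMulVec, ← hE]
    simp only [sub_mul, mul_sub, one_mul, mul_one, smul_mul_assoc, mul_smul_comm, hSR, smul_sub,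
      smul_smul, add_smul, sub_smul, one_smul]
    rw [sq]
    abel
  rw [key, Matrix.det_mul, Matrix.det_mul, det_one_sub_S, det_one_sub_R, one_mul, mul_one,
    Matrix.vecMulVec_eq Unit, Matrix.det_one_add_replicateCol_mul_replicateRow]
  have hg : ∀ m, (1 + w) * (1 + ∑ i ∈ Finset.range m, (w ^ i) * ((w ^ 2 - w) * w ^ i)) =
      1 + w ^ (2 * m + 1) := by
    intro m
    induction m with
    | zero => simp
    | succ m ih =>
      rw [Finset.sum_range_succ]
      linear_combination ih
  have := hg n
  rw [← Fin.sum_univ_eq_sum_range (fun i => (w ^ i) * ((w ^ 2 - w) * w ^ i))] at this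
  simp only [dotProduct, Pi.smul_apply, smul_eq_mul, hf]
  rw [this, show 2 * n + 1 = n + (n + 1) by ring, pow_add, hw]
  simp

open Matrix in
lemma det_rank_one (x u : K) (hx : x ^ n = 0) (hn : 0 < n) (N : ℕ → ℕ → K) :
    (1 - (u * x) • shR K n
      + (u * x) • ((mat n fun a b => x ^ (a + b + 1) * N a b) * mat n arrD)).det =
    1 + ∑ a ∈ Finset.range n, (u * x ^ 2) ^ (a + 1) * N a 0 := by
  set w := u * x with hw'
  have hw : w ^ n = 0 := by rw [hw', mul_pow, hx, mul_zero]
  set f : Fin n → K := fun a => w ^ (a : ℕ) with hf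
  have hM : w • ((mat n fun a b => x ^ (a + b + 1) * N a b) * mat n arrD) =
      Matrix.vecMulVec (fun a : Fin n => w * (x ^ ((a : ℕ) + 1) * N a 0))
        (Pi.single ⟨0, hn⟩ 1) := by
    rw [mat_mul_E]
    ext ⟨a, ha⟩ ⟨b, hb⟩
    simp [mat, arrD, Matrix.vecMulVec_apply, Pi.single_apply]
  rw [hM, ← R_vecMul w hw hn, ← Matrix.vecMulVec_mul]
  rw [show ∀ A B : Matrix (Fin n) (Fin n) K, A + B * A = (1 + B) * A from
    fun A B => by rw [add_mul, one_mul], Matrix.det_mul, det_one_sub_R, mul_one,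
    Matrix.vecMulVec_eq Unit, Matrix.det_one_add_replicateCol_mul_replicateRow]
  rw [← Fin.sum_univ_eq_sum_range (fun a => (u * x ^ 2) ^ (a + 1) * N a 0)]
  simp only [dotProduct]
  congr 1
  apply Finset.sum_congr rfl
  intro i _
  rw [hw']; ring

lemma gz_shift (x u : K) (hx : x ^ n = 0) (N : ℕ → ℕ → K) (hN : Riccati N) :
    gz n x (shiftArr u N) = (1 + u * x) * (1 + ∑ a ∈ Finset.range n, (u * x ^ 2) ^ (a + 1) * N a 0)
      * gz n x (shiftArr (u * x ^ 2) N) := by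
  rcases Nat.eq_zero_or_pos n with rfl | hn
  · have : Subsingleton K := by
      refine ⟨fun a b => ?_⟩
      have h : (1 : K) = 0 := by simpa using hx
      rw [← mul_one a, ← mul_one b, h, mul_zero, mul_zero]
    exact Subsingleton.elim _ _
  have hw : (u * x) ^ n = 0 := by rw [mul_pow, hx, mul_zero]
  have h1 := congrArg Matrix.det (claimA x u hx N)
  rw [claimB x u hx N hN, Matrix.det_mul, Matrix.det_mul, Matrix.det_mul, det_one_sub_S,
    det_rank_one x u hx hn] at h1
  have h2 := det_calK (u * x) hw hn
  unfold gz
  linear_combination (1 + u * x) * h1 -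
    ((1 - mat n fun a b => x ^ (a + b + 1) * shiftArr u N a b).det) * h2

lemma gz_iter (x : K) (hx : x ^ n = 0) (N : ℕ → ℕ → K) (hN : Riccati N) (m : ℕ) :
    gz n x (shiftArr 1 N) = (∏ j ∈ Finset.range m, ((1 + x ^ (2 * j + 1)) *
      (1 + ∑ a ∈ Finset.range n, (x ^ (2 * j + 2)) ^ (a + 1) * N a 0)))
      * gz n x (shiftArr (x ^ (2 * m)) N) := by
  induction m with
  | zero => simp
  | succ m ih =>
    rw [ih, gz_shift x (x ^ (2 * m)) hx N hN, Finset.prod_range_succ]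
    rw [show x ^ (2 * m) * x ^ 2 = x ^ (2 * (m + 1)) by ring,
      show x ^ (2 * m) * x = x ^ (2 * m + 1) by ring, show 2 * (m + 1) = 2 * m + 2 by ring]
    ring

lemma gz_final (x : K) (hx : x ^ n = 0) (N : ℕ → ℕ → K) (hN : Riccati N) (φ : ℕ → K)
    (h0 : φ 0 = 1) (hφ : ∀ a, N a 0 = φ a + φ (a + 1)) :
    gz n x (shiftArr 1 N) = (∏ j ∈ Finset.range n, ((1 + x ^ (2 * j + 1)) *
      (1 + x ^ (2 * j + 2)) * ∑ k ∈ Finset.range n, φ k * (x ^ (2 * j + 2)) ^ k))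
      * gz n x N := by
  rw [gz_iter x hx N hN n, show 2 * n = n + n by ring, pow_add, hx, mul_zero, shiftArr_zero]
  congr 1
  apply Finset.prod_congr rfl
  intro j _
  rw [mul_assoc]
  congr 1
  have hv : (x ^ (2 * j + 2)) ^ n = 0 := by
    rw [← pow_mul, mul_comm, pow_mul, hx, zero_pow (by omega)]
  generalize x ^ (2 * j + 2) = v at hv
  have : ∀ m, 1 + ∑ a ∈ Finset.range m, v ^ (a + 1) * N a 0 =
      (1 + v) * (∑ k ∈ Finset.range m, φ k * v ^ k) + v ^ m * φ m := by
    intro m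
    induction m with
    | zero => simp [h0]
    | succ m ih =>
      rw [Finset.sum_range_succ, Finset.sum_range_succ, hφ]
      linear_combination ih
  rw [this, hv]; ring
end ML

section NS

/-- `(t)_k / k!`. -/
noncomputable def pcc (t : ℂ) (k : ℕ) : ℂ := ∏ i ∈ Finset.range k, ((t + i) / (i + 1))

lemma pcc_zero (t : ℂ) : pcc t 0 = 1 := by simp [pcc]

lemma pcc_succ (t : ℂ) (k : ℕ) : pcc t (k + 1) = pcc t k * ((t + k) / (k + 1)) := by
  rw [pcc, Finset.prod_range_succ, pcc]

lemma pcc_shift (t : ℂ) (k : ℕ) : pcc (t + 1) k * t = pcc t k * (t + k) := by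
  induction k with
  | zero => simp [pcc_zero]
  | succ k ih =>
    rw [pcc_succ, pcc_succ]
    have h : (k : ℂ) + 1 ≠ 0 := by exact_mod_cast Nat.succ_ne_zero k
    push_cast
    field_simp
    linear_combination (t + k + 1) * ih

/-- The array `N_s`. -/
noncomputable def arrN (s : ℂ) (a b : ℕ) : ℂ :=
  (2 * a + 1 - s) * s * pcc (1 - s) a * pcc (1 + s) b / ((b - a + s) * (a + b + 1))

lemma nonint_ne {s : ℂ} (hs : ∀ k : ℤ, s ≠ k) (k : ℤ) : s + k ≠ 0 := fun h => hs (-k) (by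
  push_cast; linear_combination h)

lemma arrN_E3 {s : ℂ} (hs : ∀ k : ℤ, s ≠ k) (a : ℕ) :
    arrN s a 0 = pcc (-s) a + pcc (-s) (a + 1) := by
  have h1 : (a : ℂ) + 1 ≠ 0 := by exact_mod_cast Nat.succ_ne_zero a
  have h2 : s - a ≠ 0 := by have := nonint_ne hs (-a); push_cast at this; exact this
  have h3 : -s + (a : ℂ) ≠ 0 := by intro h; apply h2; linear_combination -h
  have h := pcc_shift (-s) a
  rw [show -s + 1 = 1 - s by ring] at h
  have h4 : pcc (-s) a = - (pcc (1 - s) a * s) / (-s + a) := by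
    field_simp; linear_combination -h
  rw [pcc_succ, h4, arrN, pcc_zero]
  simp only [Nat.cast_zero]
  rw [show (0 : ℂ) - a + s = -(-s + a) by ring, add_zero] 
  field_simp
  ring

lemma arrN_succ_s {s : ℂ} (hs : ∀ k : ℤ, s ≠ k) (a b : ℕ) :
    arrN (s + 1) a b = (2 * a - s) * s * pcc (1 - s) a * pcc (1 + s) b * (1 + s + b) /
      ((s - a) * (b - a + s + 1) * (a + b + 1)) := by
  have h2 : s - a ≠ 0 := by have := nonint_ne hs (-a); push_cast at this; exact this
  have h1 : 1 + s ≠ 0 := by have := nonint_ne hs 1; push_cast at this; rwa [add_comm]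
  have h := pcc_shift (-s) a
  rw [show -s + 1 = 1 - s by ring] at h
  have h4 : pcc (-s) a = (pcc (1 - s) a * s) / (s - a) := by
    field_simp; linear_combination h
  have h' := pcc_shift (1 + s) b
  have h5 : pcc (1 + s + 1) b = pcc (1 + s) b * (1 + s + b) / (1 + s) := by
    field_simp; linear_combination h'
  have h6 : (a : ℂ) + b + 1 ≠ 0 := by exact_mod_cast Nat.succ_ne_zero (a + b)
  have h7 : (b : ℂ) - a + s + 1 ≠ 0 := by
    have := nonint_ne hs (b - a + 1); push_cast at this
    intro h; apply this; linear_combination h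
  rw [arrN, show 1 - (s + 1) = -s by ring, show 1 + (s + 1) = 1 + s + 1 by ring, h4, h5,
    show (b : ℂ) - a + (s + 1) = b - a + s + 1 by ring]
  field_simp
  ring

lemma arrN_E1 {s : ℂ} (hs : ∀ k : ℤ, s ≠ k) : arrN (s + 1) = shiftArr 1 (arrN s) := by
  apply shiftArr_unique
  intro a b
  have n1 : ∀ k : ℕ, s - k ≠ 0 := fun k => by
    have := nonint_ne hs (-k); push_cast at this; exact this
  have n2 : ∀ k l : ℕ, (l : ℂ) - k + s ≠ 0 := fun k l => by
    have := nonint_ne hs (l - k); push_cast at this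
    intro h; apply this; linear_combination h
  have n3 : ∀ k : ℕ, (k : ℂ) + 1 ≠ 0 := fun k => by exact_mod_cast Nat.succ_ne_zero k
  have n4 : ∀ k l : ℕ, (k : ℂ) + l + 1 ≠ 0 := fun k l => by exact_mod_cast Nat.succ_ne_zero (k + l)
  rcases a with _ | a <;> rcases b with _ | b <;> simp only [arrPa, arrPb, arrD]
  · rw [arrN_succ_s hs, arrN]
    have := n1 0
    have := n2 0 0
    have := n2 0 1
    simp [pcc_zero] at *
    have : s + 1 ≠ 0 := by rwa [add_comm]
    field_simp
    ring
  · rw [arrN_succ_s hs, arrN_succ_s hs, arrN]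
    have h1 := n1 0
    have h2 := n2 0 b
    have h3 := n2 0 (b + 1)
    have h4 := n2 0 (b + 2)
    have h5 := n3 b
    have h6 := n3 (b + 1)
    simp only [pcc_zero, pcc_succ]
    clear n1 n2 n3 n4
    push_cast at *
    simp at *
    rw [show (b : ℂ) + s + 1 = b + 1 + s by ring, show (b : ℂ) + 1 + s + 1 = b + 2 + s by ring]
    field_simp
    ring
  · rw [arrN_succ_s hs, arrN, arrN]
    have h1 := n1 (a + 1)
    have h2 := n2 a 0
    have h3 := n2 (a + 1) 0
    have h5 := n3 a
    have h6 := n3 (a + 1)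
    simp only [pcc_zero, pcc_succ]
    clear n1 n2 n3 n4
    push_cast at *
    simp at *
    rw [show -1 + -(a : ℂ) + s + 1 = -(a - s) by ring]
    rw [show -(a : ℂ) + s = -(a - s) by ring] at *
    rw [show s - ((a : ℂ) + 1) = -(a + 1 - s) by ring] at *
    rw [show -1 + -(a : ℂ) + s = -(a + 1 - s) by ring] at *
    replace h1 := neg_ne_zero.mp h1
    replace h2 := neg_ne_zero.mp h2
    field_simp
    ring
  · rw [arrN_succ_s hs, arrN_succ_s hs, arrN, arrN]
    have h1 := n1 (a + 1)
    have h2 := n2 a b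
    have h3 := n2 a (b + 1)
    have h5 := n3 a
    have h6 := n3 b
    have h7 := n4 a (b + 1)
    have h8 := n4 a (b + 2)
    simp only [pcc_zero, pcc_succ]
    clear n1 n2 n3 n4
    push_cast at *
    rw [if_neg (by simp)]
    simp only [one_mul, mul_zero, sub_zero]
    rw [show (b : ℂ) + 1 - (a + 1) + s + 1 = b + 1 - a + s by ring,
      show (b : ℂ) - (a + 1) + s + 1 = b - a + s by ring,
      show (b : ℂ) + 1 - (a + 1) + s = b - a + s by ring,
      show (a : ℂ) + 1 + (b + 1) + 1 = a + (b + 2) + 1 by ring,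
      show (a : ℂ) + 1 + b + 1 = a + (b + 1) + 1 by ring]
    field_simp
    ring

lemma arrN_den (s : ℂ) (a b : ℕ) (A B d e : ℂ) (hA : (a : ℂ) = A) (hB : (b : ℂ) = B)
    (hd : d = B - A + s) (he : e = A + B + 1) :
    arrN s a b = (2 * A + 1 - s) * s * pcc (1 - s) a * pcc (1 + s) b / (d * e) := by
  subst hA hB hd he; rfl

lemma arrN_E2 {s : ℂ} (hs : ∀ k : ℤ, s ≠ k) : Riccati (arrN s) := by
  intro a b
  have n1 : ∀ k : ℤ, s + k ≠ 0 := nonint_ne hs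
  have n3 : ∀ k : ℕ, (k : ℂ) + 1 ≠ 0 := fun k => by exact_mod_cast Nat.succ_ne_zero k
  have hs0 : s ≠ 0 := by have := n1 0; simpa using this
  rcases a with _ | a <;> rcases b with _ | b <;> simp only [arrPa, arrPb, arrD]
  · have h1 := n1 1
    have h2 := n1 (-1)
    push_cast at h1 h2
    rw [arrN_den s 0 0 0 0 s 1, arrN_den s (0 + 1) 0 1 0 (s + -1) 2,
      arrN_den s 0 (0 + 1) 0 1 (s + 1) 2]
    · simp [pcc_zero, pcc_succ]
      field_simp
      ring
    all_goals (push_cast; ring)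
  · have h1 := n1 b
    have h2 := n1 (b + 1)
    have h3 := n1 (b + 2)
    have h4 := n3 b
    have h5 := n3 (b + 1)
    have h6 := n3 (b + 2)
    push_cast at h1 h2 h3 h4 h5 h6
    rw [show (b : ℂ) + 1 + 1 = b + 2 by ring] at h5
    rw [show (b : ℂ) + 2 + 1 = b + 3 by ring] at h6
    rw [arrN_den s 0 0 0 0 s 1, arrN_den s (0 + 1) (b + 1) 1 (b + 1) (s + b) (b + 3),
      arrN_den s 0 b 0 b (s + b) (b + 1), arrN_den s 0 (b + 1) 0 (b + 1) (s + (b + 1)) (b + 2),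
      arrN_den s 0 (b + 1 + 1) 0 (b + 2) (s + (b + 2)) (b + 3)]
    · rw [if_neg (by simp)]
      simp only [pcc_zero, pcc_succ]
      push_cast
      rw [show (b : ℂ) + 1 + 1 = b + 2 by ring, zero_add (1 : ℂ), add_zero (1 - s)]
      field_simp
      ring
    all_goals (push_cast; ring)
  · have h1 := n1 (-a)
    have h2 := n1 (-(a + 1))
    have h3 := n1 (-(a + 2))
    have h4 := n3 a
    have h5 := n3 (a + 1)
    have h6 := n3 (a + 2)
    push_cast at h1 h2 h3 h4 h5 h6
    rw [show (a : ℂ) + 1 + 1 = a + 2 by ring] at h5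
    rw [show (a : ℂ) + 2 + 1 = a + 3 by ring] at h6
    rw [← sub_eq_add_neg] at h1 h2 h3
    rw [arrN_den s 0 0 0 0 s 1, arrN_den s (a + 1) (0 + 1) (a + 1) 1 (s - a) (a + 3),
      arrN_den s a 0 a 0 (s - a) (a + 1), arrN_den s (a + 1) 0 (a + 1) 0 (s - (a + 1)) (a + 2),
      arrN_den s (a + 1 + 1) 0 (a + 2) 0 (s - (a + 2)) (a + 3)]
    · rw [if_neg (by simp)]
      simp only [pcc_zero, pcc_succ]
      push_cast
      rw [show (a : ℂ) + 1 + 1 = a + 2 by ring, zero_add (1 : ℂ), add_zero (1 + s)]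
      field_simp
      ring
    all_goals (push_cast; ring)
  · have h1 := n1 (b + 1 - a)
    have h2 := n1 (b - 1 - a)
    have h3 := n1 (-(a + 1))
    have h4 := n3 a
    have h5 := n3 (a + 1)
    have h6 := n3 b
    have h7 := n3 (b + 1)
    have h8 := n3 (a + b + 1)
    have h9 := n3 (a + b + 3)
    have h10 := n1 (b + 1)
    push_cast at h1 h2 h3 h4 h5 h6 h7 h8 h9 h10
    rw [← sub_eq_add_neg] at h3
    rw [show (a : ℂ) + 1 + 1 = a + 2 by ring] at h5
    rw [show (b : ℂ) + 1 + 1 = b + 2 by ring] at h7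
    rw [show (a : ℂ) + b + 1 + 1 = a + b + 2 by ring] at h8
    rw [show (a : ℂ) + b + 3 + 1 = a + b + 4 by ring] at h9
    rw [arrN_den s a (b + 1) a (b + 1) (s + (b + 1 - a)) (a + b + 2),
      arrN_den s (a + 1 + 1) (b + 1) (a + 2) (b + 1) (s + (b - 1 - a)) (a + b + 4),
      arrN_den s (a + 1) b (a + 1) b (s + (b - 1 - a)) (a + b + 2),
      arrN_den s (a + 1) (b + 1 + 1) (a + 1) (b + 2) (s + (b + 1 - a)) (a + b + 4),
      arrN_den s (a + 1) 0 (a + 1) 0 (s - (a + 1)) (a + 2),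
      arrN_den s 0 (b + 1) 0 (b + 1) (s + (b + 1)) (b + 2)]
    · rw [if_neg (by simp)]
      simp only [pcc_zero, pcc_succ]
      push_cast
      rw [show (a : ℂ) + 1 + 1 = a + 2 by ring, show (b : ℂ) + 1 + 1 = b + 2 by ring]
      field_simp
      ring
    all_goals (push_cast; ring)
end NS

section MIN

lemma det_one_add_minors {R : Type*} [CommRing R] {n : ℕ} (M : Matrix (Fin n) (Fin n) R) :
    (1 + M).det = ∑ A : Finset (Fin n),
      (M.submatrix (Subtype.val : A → Fin n) (Subtype.val : A → Fin n)).det := by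
  rw [add_comm]
  have h := (Matrix.detRowAlternating (R := R) (n := Fin n)).toMultilinearMap.map_add_univ
    M.row (1 : Matrix (Fin n) (Fin n) R).row
  refine Eq.trans ?_ (h.trans ?_)
  · rfl
  · exact Finset.sum_congr rfl fun s _ => Matrix.det_piecewise_one_eq_submatrix_det M s

/-- Principal minor of an array. -/
def minor {R : Type*} [CommRing R] (N : ℕ → ℕ → R) (A : Finset ℕ) : R :=
  (Matrix.of fun i j : A => N i j).det

lemma minor_map {R S : Type*} [CommRing R] [CommRing S] (f : R →+* S) (N : ℕ → ℕ → R)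
    (A : Finset ℕ) : minor (fun a b => f (N a b)) A = f (minor N A) := by
  rw [minor, minor, RingHom.map_det]
  rfl

lemma gz_expand {R : Type*} [CommRing R] (n : ℕ) (x : R) (N : ℕ → ℕ → R) :
    gz n x N = ∑ A ∈ (Finset.range n).powerset,
      (-1) ^ A.card * x ^ (∑ a ∈ A, (2 * a + 1)) * minor N A := by
  rw [gz, sub_eq_add_neg, det_one_add_minors]
  refine Finset.sum_bij' (fun A _ => A.map Fin.valEmbedding)
    (fun A _ => Finset.univ.filter fun i : Fin n => (i : ℕ) ∈ A) ?_ ?_ ?_ ?_ ?_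
  · intro A _
    simp only [Finset.mem_powerset]
    intro i hi
    simp only [Finset.mem_map, Fin.valEmbedding_apply] at hi
    obtain ⟨a, _, rfl⟩ := hi
    simp
  · intro A _; simp
  · intro A _; ext i; simp [Fin.val_inj]
  · intro A hA
    ext i
    simp only [Finset.mem_map, Finset.mem_filter, Finset.mem_univ, true_and, Fin.valEmbedding_apply]
    constructor
    · rintro ⟨a, ha, rfl⟩; exact ha
    · intro hi
      exact ⟨⟨i, by simpa using Finset.mem_powerset.mp hA hi⟩, hi, rfl⟩
  · intro A _
    let e : A ≃ (A.map Fin.valEmbedding : Finset ℕ) := Finset.equivMap Fin.valEmbedding A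
    rw [minor, ← Matrix.det_submatrix_equiv_self e, Finset.card_map, Finset.sum_map]
    have h1 : ((-mat n fun a b => x ^ (a + b + 1) * N a b).submatrix
        (Subtype.val : A → Fin n) (Subtype.val : A → Fin n)) =
        Matrix.of fun i j : A => (-x ^ ((i : Fin n) : ℕ)) *
          (Matrix.of fun i j : A => (x ^ (((j : Fin n) : ℕ) + 1)) *
          ((Matrix.of fun i j : (A.map Fin.valEmbedding : Finset ℕ) => N i j).submatrix e e) i j)
            i j := by
      ext i j
      simp only [mat, Matrix.submatrix_apply, Matrix.neg_apply, Matrix.of_apply, e]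
      simp only [Finset.equivMap_apply_coe, Fin.valEmbedding_apply]
      ring
    rw [h1, Matrix.det_mul_column, Matrix.det_mul_row, ← mul_assoc]
    congr 1
    rw [Finset.prod_coe_sort A (fun i => -x ^ (i : ℕ)), Finset.prod_coe_sort A (fun i => x ^ ((i : ℕ) + 1)),
      Finset.prod_neg, Finset.prod_pow_eq_pow_sum, Finset.prod_pow_eq_pow_sum, mul_assoc, ← pow_add,
      ← Finset.sum_add_distrib]
    congr 2
    apply Finset.sum_congr rfl
    intro i _
    simp only [Fin.valEmbedding_apply]; ring

lemma minor_empty {R : Type*} [CommRing R] (N : ℕ → ℕ → R) : minor N ∅ = 1 := by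
  simp [minor]

lemma minor_insert {F : Type*} [Field F] (r c x y : ℕ → F) (N : ℕ → ℕ → F)
    (hN : ∀ i j, N i j = r i * c j / (y j - x i)) (hxy : ∀ i j, y j - x i ≠ 0)
    (hr : ∀ i, r i ≠ 0) (hc : ∀ i, c i ≠ 0) (a : ℕ) (B : Finset ℕ) (ha : a ∉ B) :
    minor N (insert a B) = N a a * (∏ b ∈ B, ((y a - y b) * (x b - x a) /
      ((y a - x b) * (y b - x a)))) * minor N B := by
  let e : (insert a B : Finset ℕ) ≃ B ⊕ PUnit.{1} :=
    (Finset.subtypeInsertEquivOption ha).trans (Equiv.optionEquivSumPUnit _)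
  have haa : N a a ≠ 0 := by
    rw [hN]; exact div_ne_zero (mul_ne_zero (hr a) (hc a)) (hxy a a)
  letI : Invertible (Matrix.of fun _ _ : PUnit.{1} => N a a) :=
    ⟨Matrix.of fun _ _ => (N a a)⁻¹, by ext; simp [Matrix.mul_apply, haa],
      by ext; simp [Matrix.mul_apply, haa]⟩
  have hb : (Matrix.of fun i j : (insert a B : Finset ℕ) => N i j).submatrix e.symm e.symm =
      Matrix.fromBlocks (Matrix.of fun i j : B => N i j) (Matrix.of fun (i : B) _ => N i a)
        (Matrix.of fun _ (j : B) => N a j) (Matrix.of fun _ _ => N a a) := by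
    ext (i | i) (j | j) <;> rfl
  rw [minor, ← Matrix.det_submatrix_equiv_self e.symm, hb, Matrix.det_fromBlocks₂₂]
  have h2 : ((Matrix.of fun i j : B => N i j) -
      (Matrix.of fun i _ => N i a : Matrix B PUnit.{1} F) *
      ⅟(Matrix.of fun _ _ => N a a : Matrix PUnit.{1} PUnit.{1} F) *
      (Matrix.of fun _ j => N a j : Matrix PUnit.{1} B F)) =
      Matrix.of fun i j : B => ((x i - x a) / (y a - x i)) *
        (Matrix.of fun i j : B => ((y a - y j) / (y j - x a)) *
          (Matrix.of fun i j : B => N i j) i j) i j := by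
    ext i j
    have h3 : ⅟(Matrix.of fun _ _ : PUnit.{1} => N a a) = Matrix.of fun _ _ => (N a a)⁻¹ := rfl
    rw [h3]
    simp only [Matrix.sub_apply, Matrix.mul_apply, Matrix.of_apply, Finset.univ_unique,
      Finset.sum_singleton]
    have k1 := hxy i j
    have k2 := hxy i a
    have k3 := hxy a j
    have k4 := hxy a a
    have k5 := hr a
    have k6 := hc a
    simp only [hN]
    field_simp
    ring
  rw [h2, Matrix.det_mul_column, Matrix.det_mul_row, Matrix.det_unique, Matrix.of_apply,
    Finset.prod_coe_sort B (fun i => (x i - x a) / (y a - x i)),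
    Finset.prod_coe_sort B (fun j => (y a - y j) / (y j - x a)), ← mul_assoc (∏ _ ∈ B, _),
    ← Finset.prod_mul_distrib, ← mul_assoc, ← minor]
  congr 2
  apply Finset.prod_congr rfl
  intro b _
  rw [div_mul_div_comm, mul_comm (x b - x a)]

lemma minor_arrN_insert {s : ℂ} (hs : ∀ k : ℤ, s ≠ k) (a : ℕ) (B : Finset ℕ) (ha : a ∉ B) :
    minor (arrN s) (insert a B) * ∏ b ∈ B, (1 - s ^ 2 / ((a : ℂ) - b) ^ 2) =
      (1 - s / (2 * a + 1)) * (∏ h ∈ Finset.range a, (1 - s ^ 2 / ((h : ℂ) + 1) ^ 2)) *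
      (∏ b ∈ B, (1 - s ^ 2 / ((a : ℂ) + b + 1) ^ 2)) * minor (arrN s) B := by
  have n1 : ∀ k : ℤ, s + k ≠ 0 := nonint_ne hs
  have n3 : ∀ k : ℕ, (k : ℂ) + 1 ≠ 0 := fun k => by exact_mod_cast Nat.succ_ne_zero k
  have hs0 : s ≠ 0 := by have := n1 0; simpa using this
  have n4 : ∀ a b : ℕ, (b : ℂ) - a + s ≠ 0 := fun a b => by
    have := n1 (b - a); push_cast at this; rwa [add_comm]
  have n5 : ∀ a b : ℕ, (a : ℂ) + b + 1 ≠ 0 := fun k l => by exact_mod_cast Nat.succ_ne_zero (k + l)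
  have n2 : ∀ a b : ℕ, ((b : ℂ) - a + s) * (a + b + 1) ≠ 0 := fun a b =>
    mul_ne_zero (n4 a b) (n5 a b)
  have hfac : ∀ a b : ℕ, ((b : ℂ) + (1 + s) / 2) ^ 2 - ((a : ℂ) + (1 - s) / 2) ^ 2 =
      ((b : ℂ) - a + s) * (a + b + 1) := fun a b => by ring
  have hpcc1 : ∀ i, pcc (1 - s) i ≠ 0 := by
    intro i
    rw [pcc, Finset.prod_ne_zero_iff]
    intro k _
    apply div_ne_zero _ (n3 k)
    have := n1 (-1 - k); push_cast at this
    intro h; apply this; linear_combination -h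
  have hpcc2 : ∀ i, pcc (1 + s) i ≠ 0 := by
    intro i
    rw [pcc, Finset.prod_ne_zero_iff]
    intro k _
    apply div_ne_zero _ (n3 k)
    have := n1 (1 + k); push_cast at this
    intro h; apply this; linear_combination h
  rw [minor_insert (fun i : ℕ => (2 * (i : ℂ) + 1 - s) * s * pcc (1 - s) i) (fun j => pcc (1 + s) j)
    (fun i : ℕ => ((i : ℂ) + (1 - s) / 2) ^ 2) (fun j : ℕ => ((j : ℂ) + (1 + s) / 2) ^ 2)
    (arrN s) (fun i j => by rw [hfac]; rfl) (fun i j => by rw [hfac]; exact n2 i j)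
    (fun i => mul_ne_zero (mul_ne_zero (by
      have := n1 (-2 * i - 1); push_cast at this
      intro h; apply this; linear_combination -h) hs0) (hpcc1 i)) hpcc2 a B ha]
  have e1 : arrN s a a =
      (1 - s / (2 * a + 1)) * (∏ h ∈ Finset.range a, (1 - s ^ 2 / ((h : ℂ) + 1) ^ 2)) := by
    have : (∏ h ∈ Finset.range a, (1 - s ^ 2 / ((h : ℂ) + 1) ^ 2)) =
        pcc (1 - s) a * pcc (1 + s) a := by
      rw [pcc, pcc, ← Finset.prod_mul_distrib]
      apply Finset.prod_congr rfl
      intro h _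
      have := n3 h
      field_simp
      ring
    rw [this, arrN]
    have h2 : (2 * (a : ℂ) + 1) ≠ 0 := by exact_mod_cast Nat.succ_ne_zero (2 * a)
    rw [show (a : ℂ) - a + s = s by ring, show (a : ℂ) + a + 1 = 2 * a + 1 by ring]
    field_simp
  rw [← e1]
  have e2 : (∏ b ∈ B, ((((a : ℂ) + (1 + s) / 2) ^ 2 - ((b : ℂ) + (1 + s) / 2) ^ 2) *
      (((b : ℂ) + (1 - s) / 2) ^ 2 - ((a : ℂ) + (1 - s) / 2) ^ 2) /
      ((((a : ℂ) + (1 + s) / 2) ^ 2 - ((b : ℂ) + (1 - s) / 2) ^ 2) *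
        (((b : ℂ) + (1 + s) / 2) ^ 2 - ((a : ℂ) + (1 - s) / 2) ^ 2)))) *
      (∏ b ∈ B, (1 - s ^ 2 / ((a : ℂ) - b) ^ 2)) =
      ∏ b ∈ B, (1 - s ^ 2 / ((a : ℂ) + b + 1) ^ 2) := by
    rw [← Finset.prod_mul_distrib]
    apply Finset.prod_congr rfl
    intro b hb
    have hab : (a : ℂ) - b ≠ 0 := by
      rw [sub_ne_zero]; intro h; apply ha; rw [Nat.cast_inj.mp h]; exact hb
    have k1 := n4 a b
    have k2 := n4 b a
    have k3 := n5 a b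
    rw [hfac, hfac, show (b : ℂ) + a + 1 = a + b + 1 by ring]
    field_simp
    ring
  rw [← e2]
  ring
end MIN

section COMB

/-- Number of elements at least `d`. -/
def cnt (A : Finset ℕ) (d : ℕ) : ℕ := (A.filter fun a => d ≤ a).card

lemma cnt_anti (A : Finset ℕ) {d e : ℕ} (h : d ≤ e) : cnt A e ≤ cnt A d := by
  apply Finset.card_le_card
  intro a
  simp only [Finset.mem_filter]
  rintro ⟨h1, h2⟩; exact ⟨h1, by omega⟩

lemma cnt_le (A : Finset ℕ) {d e : ℕ} (h : d ≤ e) : cnt A d ≤ cnt A e + (e - d) := by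
  have : (A.filter fun a => d ≤ a) ⊆ (A.filter fun a => e ≤ a) ∪ Finset.Ico d e := by
    intro a
    simp only [Finset.mem_filter, Finset.mem_union, Finset.mem_Ico]
    intro h; by_cases e ≤ a <;> simp_all
  calc cnt A d ≤ _ := Finset.card_le_card this
    _ ≤ _ := Finset.card_union_le _ _
    _ = _ := by rw [Nat.card_Ico]; rfl

lemma cnt_eq_zero (A : Finset ℕ) {d : ℕ} (h : ∀ a ∈ A, a < d) : cnt A d = 0 := by
  rw [cnt, Finset.card_eq_zero, Finset.filter_eq_empty_iff]
  intro a ha; have := h a ha; omega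

/-- The self-conjugate diagram with given Frobenius coordinates. -/
def dgm (A : Finset ℕ) : YoungDiagram where
  cells := ((Finset.range (A.card + A.sup id + 1)) ×ˢ
    (Finset.range (A.card + A.sup id + 1))).filter fun c =>
      min c.1 c.2 < cnt A (max c.1 c.2 - min c.1 c.2)
  isLowerSet := by
    rintro ⟨i', j'⟩ ⟨i, j⟩ hle h
    have h1 : i ≤ i' := hle.1
    have h2 : j ≤ j' := hle.2
    simp only [Finset.coe_filter, Finset.mem_product, Finset.mem_range, Set.mem_setOf_eq] at h ⊢
    refine ⟨⟨by omega, by omega⟩, ?_⟩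
    have h3 := h.2
    rcases le_total (max i j - min i j) (max i' j' - min i' j') with hd | hd
    · have := cnt_anti A hd; omega
    · have := cnt_le A hd; omega

lemma mem_dgm (A : Finset ℕ) (i j : ℕ) :
    (i, j) ∈ dgm A ↔ min i j < cnt A (max i j - min i j) := by
  rw [← YoungDiagram.mem_cells, dgm]
  simp only [Finset.mem_filter, Finset.mem_product, Finset.mem_range, and_iff_right_iff_imp]
  intro h
  have h1 : cnt A (max i j - min i j) ≤ A.card := Finset.card_le_card (Finset.filter_subset _ _)
  have h2 : 0 < cnt A (max i j - min i j) := by omega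
  rw [cnt, Finset.card_pos] at h2
  obtain ⟨a, ha⟩ := h2
  rw [Finset.mem_filter] at ha
  have h3 : a ≤ A.sup id := Finset.le_sup (f := id) ha.1
  omega

lemma dgm_transpose (A : Finset ℕ) : (dgm A).transpose = dgm A := by
  ext ⟨i, j⟩
  rw [YoungDiagram.mem_cells, YoungDiagram.mem_cells, YoungDiagram.mem_transpose]
  simp only [Prod.swap_prod_mk, mem_dgm]
  rw [min_comm, max_comm]

lemma dgm_colLen (A : Finset ℕ) (i : ℕ) : (dgm A).colLen i = (dgm A).rowLen i := by
  rw [← YoungDiagram.rowLen_transpose, dgm_transpose]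

lemma cnt_succ (A : Finset ℕ) (d : ℕ) : cnt A d = cnt A (d + 1) + if d ∈ A then 1 else 0 := by
  have h1 : (A.filter fun a => d ≤ a) = (A.filter fun a => d + 1 ≤ a) ∪ (A.filter fun a => a = d) := by
    ext a; simp only [Finset.mem_filter, Finset.mem_union]
    by_cases a ∈ A <;> simp_all <;> omega
  rw [cnt, h1, Finset.card_union_of_disjoint, cnt, Finset.filter_eq']
  · split_ifs <;> simp
  · rw [Finset.disjoint_left]
    intro a; simp only [Finset.mem_filter]; omega

lemma dgm_injective : Function.Injective dgm := by
  intro A B h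
  have hc : ∀ d, cnt A d = cnt B d := by
    intro d
    have key : ∀ m, m < cnt A d ↔ m < cnt B d := by
      intro m
      have h1 := mem_dgm A m (m + d)
      have h2 := mem_dgm B m (m + d)
      rw [show min m (m + d) = m by omega, show max m (m + d) - m = d by omega] at h1 h2
      rw [← h1, ← h2, h]
    have h1 := key (cnt A d)
    have h2 := key (cnt B d)
    omega
  ext a
  have h1 := cnt_succ A a
  have h2 := cnt_succ B a
  rw [hc a, hc (a + 1)] at h1
  by_cases a ∈ A <;> by_cases a ∈ B <;> simp_all

lemma dgm_surjective (μ : YoungDiagram) (hμ : μ.transpose = μ) : ∃ A, dgm A = μ := by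
  classical
  have hex : ∀ d, ∃ m, (m, m + d) ∉ μ := by
    intro d
    refine ⟨μ.colLen d, fun h => ?_⟩
    have h2 : (μ.colLen d, d) ∈ μ := μ.up_left_mem le_rfl (by omega) h
    rw [YoungDiagram.mem_iff_lt_colLen] at h2
    omega
  let c : ℕ → ℕ := fun d => Nat.find (hex d)
  have hc : ∀ d m, m < c d ↔ (m, m + d) ∈ μ := by
    intro d m
    rw [Nat.lt_find_iff]
    constructor
    · intro h; simpa using h m le_rfl
    · intro h k hk; rw [not_not]; exact μ.up_left_mem hk (by omega) h
  have h1 : ∀ d, c (d + 1) ≤ c d := by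
    intro d
    by_contra hlt
    push Not at hlt
    have := (hc (d + 1) (c d)).mp hlt
    have h2 : (c d, c d + d) ∈ μ := μ.up_left_mem le_rfl (by omega) this
    have := (hc d (c d)).mpr h2
    omega
  have h2 : ∀ d, c d ≤ c (d + 1) + 1 := by
    intro d
    by_contra hlt
    push Not at hlt
    have h3 := (hc d (c (d + 1) + 1)).mp hlt
    have h4 : (c (d + 1), c (d + 1) + (d + 1)) ∈ μ := μ.up_left_mem (by omega) (by omega) h3
    have := (hc _ _).mpr h4
    omega
  have h0 : ∀ d, μ.rowLen 0 ≤ d → c d = 0 := by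
    intro d hd
    by_contra hne
    have := (hc d 0).mp (by omega)
    rw [YoungDiagram.mem_iff_lt_rowLen] at this
    omega
  let A := (Finset.range (μ.rowLen 0)).filter fun a => c (a + 1) < c a
  have hcA : ∀ k d, μ.rowLen 0 ≤ d + k → cnt A d = c d := by
    intro k
    induction k with
    | zero =>
      intro d hd
      rw [h0 d (by omega)]
      apply cnt_eq_zero
      intro a ha
      have := (Finset.mem_filter.mp ha).1
      rw [Finset.mem_range] at this
      omega
    | succ k ih =>
      intro d hd
      rw [cnt_succ, ih (d + 1) (by omega)]
      have h3 := h1 d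
      have h4 := h2 d
      by_cases hlt : c (d + 1) < c d
      · have : d ∈ A := by
          refine Finset.mem_filter.mpr ⟨?_, hlt⟩
          rw [Finset.mem_range]
          by_contra hge
          have := h0 d (by omega)
          omega
        rw [if_pos this]; omega
      · have : d ∉ A := fun h => hlt (Finset.mem_filter.mp h).2
        rw [if_neg this]; omega
  refine ⟨A, ?_⟩
  ext ⟨i, j⟩
  rw [YoungDiagram.mem_cells, YoungDiagram.mem_cells, mem_dgm, hcA (μ.rowLen 0) _ (by omega), hc]
  rcases le_total i j with h | h
  · rw [min_eq_left h, max_eq_right h, show i + (j - i) = j by omega]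
  · rw [min_eq_right h, max_eq_left h, show j + (i - j) = i by omega]
    conv_lhs => rw [← hμ]
    rw [YoungDiagram.mem_transpose, Prod.swap_prod_mk]

lemma cnt_insert (a : ℕ) (B : Finset ℕ) (h : ∀ b ∈ B, b < a) (d : ℕ) :
    cnt (insert a B) d = if d ≤ a then cnt B d + 1 else 0 := by
  have ha : a ∉ B := fun h' => lt_irrefl _ (h a h')
  split_ifs with hd
  · rw [cnt, Finset.filter_insert, if_pos hd, Finset.card_insert_of_notMem]
    · rfl
    · simp [ha]
  · apply cnt_eq_zero
    intro b hb
    rcases Finset.mem_insert.mp hb with rfl | hb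
    · omega
    · have := h b hb; omega

lemma mem_dgm_succ (a : ℕ) (B : Finset ℕ) (h : ∀ b ∈ B, b < a) (i j : ℕ) :
    (i + 1, j + 1) ∈ dgm (insert a B) ↔ (i, j) ∈ dgm B := by
  rw [mem_dgm, mem_dgm, cnt_insert a B h,
    show max (i + 1) (j + 1) - min (i + 1) (j + 1) = max i j - min i j by omega]
  split_ifs with hd
  · omega
  · rw [cnt_eq_zero B]
    · simp
    · intro b hb; have := h b hb; omega

lemma mem_dgm_zero (a : ℕ) (B : Finset ℕ) (h : ∀ b ∈ B, b < a) (j : ℕ) :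
    (0, j) ∈ dgm (insert a B) ↔ j ≤ a := by
  rw [mem_dgm, cnt_insert a B h, show max 0 j - min 0 j = j by omega]
  split_ifs <;> omega

lemma mem_dgm_zero' (a : ℕ) (B : Finset ℕ) (h : ∀ b ∈ B, b < a) (j : ℕ) :
    (j, 0) ∈ dgm (insert a B) ↔ j ≤ a := by
  rw [mem_dgm, cnt_insert a B h, show max j 0 - min j 0 = j by omega]
  split_ifs <;> omega

lemma nat_eq_of_lt_iff {x y : ℕ} (h : ∀ m, m < x ↔ m < y) : x = y := by
  have h1 := h x
  have h2 := h y
  omega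

lemma rowLen_zero (a : ℕ) (B : Finset ℕ) (h : ∀ b ∈ B, b < a) :
    (dgm (insert a B)).rowLen 0 = a + 1 := by
  apply nat_eq_of_lt_iff
  intro m
  rw [← YoungDiagram.mem_iff_lt_rowLen, mem_dgm_zero a B h]
  omega

lemma rowLen_succ (a : ℕ) (B : Finset ℕ) (h : ∀ b ∈ B, b < a) (i : ℕ) (hi : i < a) :
    (dgm (insert a B)).rowLen (i + 1) = (dgm B).rowLen i + 1 := by
  apply nat_eq_of_lt_iff
  intro m
  rw [← YoungDiagram.mem_iff_lt_rowLen]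
  rcases m with _ | m
  · rw [mem_dgm_zero' a B h]; omega
  · rw [mem_dgm_succ a B h, YoungDiagram.mem_iff_lt_rowLen]; omega

lemma rowLen_large (B : Finset ℕ) (i : ℕ) (h : ∀ b ∈ B, b < i) : (dgm B).rowLen i = 0 := by
  apply nat_eq_of_lt_iff
  intro m
  rw [← YoungDiagram.mem_iff_lt_rowLen, mem_dgm]
  constructor
  · intro h'
    have hi : i ≤ max i m - min i m ∨ max i m - min i m < i := by omega
    rcases Nat.lt_or_ge (max i m - min i m) i with h2 | h2
    · have h3 := cnt_le B (le_of_lt h2)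
      rw [cnt_eq_zero B h] at h3
      exfalso
      have : (dgm B) = dgm B := rfl
      have h4 : (i, 0) ∈ dgm B := (dgm B).up_left_mem le_rfl (Nat.zero_le m) ((mem_dgm B i m).mpr h')
      rw [mem_dgm, show max i 0 - min i 0 = i by omega, cnt_eq_zero B h] at h4
      omega
    · have := cnt_anti B h2
      rw [cnt_eq_zero B h] at this
      omega
  · omega

lemma cells_prod {M : Type*} [CommMonoid M] (g : ℕ × ℕ → M) (a : ℕ) (B : Finset ℕ)
    (h : ∀ b ∈ B, b < a) :
    ∏ c ∈ (dgm (insert a B)).cells, g c = g (0, 0) * (∏ j ∈ Finset.range a, (g (0, j + 1) *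
      g (j + 1, 0))) * ∏ c ∈ (dgm B).cells, g (c.1 + 1, c.2 + 1) := by
  let f1 : ℕ → ℕ × ℕ := fun j => (0, j + 1)
  let f2 : ℕ → ℕ × ℕ := fun j => (j + 1, 0)
  let f3 : ℕ × ℕ → ℕ × ℕ := fun c => (c.1 + 1, c.2 + 1)
  have hf1 : ∀ j, f1 j = (0, j + 1) := fun _ => rfl
  have hf2 : ∀ j, f2 j = (j + 1, 0) := fun _ => rfl
  have hf3 : ∀ c, f3 c = (c.1 + 1, c.2 + 1) := fun _ => rfl
  have hcells : (dgm (insert a B)).cells = {(0, 0)} ∪ (Finset.range a).image f1 ∪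
      (Finset.range a).image f2 ∪ (dgm B).cells.image f3 := by
    ext ⟨i, j⟩
    rw [YoungDiagram.mem_cells]
    simp only [Finset.mem_union, Finset.mem_image, Finset.mem_singleton, Finset.mem_range,
      YoungDiagram.mem_cells, hf1, hf2, hf3, Prod.mk.injEq, Prod.exists]
    rcases i with _ | i <;> rcases j with _ | j
    · simp [mem_dgm_zero a B h]
    · simp [mem_dgm_zero a B h, Nat.succ_le_iff]
    · simp [mem_dgm_zero' a B h, Nat.succ_le_iff]
    · simp [mem_dgm_succ a B h]
  have d1 : Disjoint ({(0, 0)} : Finset (ℕ × ℕ)) ((Finset.range a).image f1) := by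
    rw [Finset.disjoint_left]
    rintro ⟨i, j⟩
    simp only [Finset.mem_image, Finset.mem_singleton, hf1, Prod.mk.injEq]
    rintro ⟨_, _⟩ ⟨k, _, _, _⟩; omega
  have d2 : Disjoint ({(0, 0)} ∪ ((Finset.range a).image f1)) ((Finset.range a).image f2) := by
    rw [Finset.disjoint_left]
    rintro ⟨i, j⟩
    simp only [Finset.mem_union, Finset.mem_image, Finset.mem_singleton, hf1, hf2, Prod.mk.injEq]
    rintro (⟨_, _⟩ | ⟨l, _, _, _⟩) ⟨k, _, _, _⟩ <;> omega
  have d3 : Disjoint ({(0, 0)} ∪ ((Finset.range a).image f1) ∪ ((Finset.range a).image f2))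
      ((dgm B).cells.image f3) := by
    rw [Finset.disjoint_left]
    rintro ⟨i, j⟩
    simp only [Finset.mem_union, Finset.mem_image, Finset.mem_singleton, hf1, hf2, hf3,
      Prod.mk.injEq]
    rintro ((⟨_, _⟩ | ⟨l, _, _, _⟩) | ⟨l, _, _, _⟩) ⟨k, _, _, _⟩ <;> omega
  rw [hcells, Finset.prod_union d3, Finset.prod_union d2, Finset.prod_union d1, Finset.prod_image,
    Finset.prod_image, Finset.prod_image, Finset.prod_singleton, Finset.prod_mul_distrib]
  · simp only [hf1, hf2, hf3, mul_assoc]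
  · rintro ⟨i, j⟩ _ ⟨k, l⟩ _
    simp only [hf3, Prod.mk.injEq]; omega
  · intro i _ j _
    simp only [hf2, Prod.mk.injEq]; omega
  · intro i _ j _
    simp only [hf1, Prod.mk.injEq]; omega

lemma dgm_empty_cells : (dgm ∅).cells = ∅ := by
  ext ⟨i, j⟩
  rw [YoungDiagram.mem_cells, mem_dgm]
  simp [cnt]

lemma dgm_card (A : Finset ℕ) : (dgm A).card = ∑ a ∈ A, (2 * a + 1) := by
  induction A using Finset.induction_on_max with
  | empty => rw [YoungDiagram.card, dgm_empty_cells]; simp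
  | insert a B h ih =>
    have ha : a ∉ B := fun h' => lt_irrefl _ (h a h')
    rw [Finset.sum_insert ha, ← ih]
    have := cells_prod (fun _ => 2) a B h
    simp only [Finset.prod_const, Finset.card_range] at this
    apply Nat.pow_right_injective (le_refl 2)
    change 2 ^ (dgm (insert a B)).cells.card = 2 ^ (2 * a + 1 + (dgm B).cells.card)
    rw [this, pow_add, pow_add, pow_mul]
    norm_num; ring

lemma dgm_durfee (A : Finset ℕ) : durfee (dgm A) = A.card := by
  induction A using Finset.induction_on_max with
  | empty => rw [durfee, dgm_empty_cells]; simp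
  | insert a B h ih =>
    have ha : a ∉ B := fun h' => lt_irrefl _ (h a h')
    rw [Finset.card_insert_of_notMem ha, ← ih]
    have := cells_prod (fun c => if c.1 = c.2 then 2 else 1) a B h
    simp only [Finset.prod_ite, Finset.prod_const, one_pow, mul_one, add_left_inj, reduceIte,
      Nat.add_one_ne_zero, Nat.zero_ne_add_one, Finset.prod_const_one] at this
    apply Nat.pow_right_injective (le_refl 2)
    change 2 ^ durfee (dgm (insert a B)) = 2 ^ (durfee (dgm B) + 1)
    rw [durfee, this, pow_succ, durfee]
    simp [mul_comm]

/-- Product over the hooks of the first row. -/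
def rowProd (g : ℕ → ℂ) (B : Finset ℕ) (a : ℕ) : ℂ :=
  ∏ j ∈ Finset.range a, g (a - j + (dgm B).rowLen j)

lemma rowProd_insert (g : ℕ → ℂ) (C : Finset ℕ) (a b : ℕ) (hC : ∀ c ∈ C, c < b) (hab : b < a) :
    rowProd g (insert b C) a * g (a - b) = g (a + b + 1) * rowProd g C a := by
  obtain ⟨k, rfl⟩ : ∃ k, a = b + 1 + k := ⟨a - (b + 1), by omega⟩
  rw [rowProd, rowProd, Finset.prod_range_add _ (b + 1) k, Finset.prod_range_add _ (b + 1) k,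
    Finset.prod_range_succ' _ b, Finset.prod_range_succ _ b]
  have e1 : ∏ j ∈ Finset.range b, g (b + 1 + k - (j + 1) + (dgm (insert b C)).rowLen (j + 1)) =
      ∏ j ∈ Finset.range b, g (b + 1 + k - j + (dgm C).rowLen j) := by
    apply Finset.prod_congr rfl
    intro j hj
    rw [Finset.mem_range] at hj
    rw [rowLen_succ b C hC j hj]
    congr 1; omega
  have e2 : ∏ j ∈ Finset.range k, g (b + 1 + k - (b + 1 + j) + (dgm (insert b C)).rowLen (b + 1 + j)) =
      ∏ j ∈ Finset.range k, g (b + 1 + k - (b + 1 + j) + (dgm C).rowLen (b + 1 + j)) := by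
    apply Finset.prod_congr rfl
    intro j hj
    rw [rowLen_large, rowLen_large]
    · intro c hc; have := hC c hc; omega
    · intro c hc
      rcases Finset.mem_insert.mp hc with rfl | hc
      · omega
      · have := hC c hc; omega
  rw [e1, e2, rowLen_zero b C hC, rowLen_large C b hC,
    show b + 1 + k - 0 + (b + 1) = b + 1 + k + b + 1 by omega, add_zero]
  ring

lemma rowProd_eq (g : ℕ → ℂ) (B : Finset ℕ) (a : ℕ) (h : ∀ b ∈ B, b < a) :
    rowProd g B a * ∏ b ∈ B, g (a - b) =
      (∏ i ∈ Finset.range a, g (i + 1)) * ∏ b ∈ B, g (a + b + 1) := by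
  induction B using Finset.induction_on_max with
  | empty =>
    simp only [Finset.prod_empty, mul_one, rowProd]
    rw [← Finset.prod_range_reflect]
    apply Finset.prod_congr rfl
    intro j hj
    rw [Finset.mem_range] at hj
    rw [rowLen_large _ _ (by simp)]
    congr 1; omega
  | insert b C hC ih =>
    have hb : b ∉ C := fun h' => lt_irrefl _ (hC b h')
    rw [Finset.prod_insert hb, Finset.prod_insert hb]
    have h1 := ih fun c hc => h c (Finset.mem_insert_of_mem hc)
    have h2 := rowProd_insert g C a b hC (h b (Finset.mem_insert_self _ _))
    linear_combination (∏ c ∈ C, g (a - c)) * h2 + g (a + b + 1) * h1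

/-- The hook product. -/
def hprod (s : ℂ) (μ : YoungDiagram) : ℂ :=
  ∏ c ∈ μ.cells, (1 - s / ((hookLen μ c : ℂ) * eps c))

lemma hprod_insert (s : ℂ) (a : ℕ) (B : Finset ℕ) (h : ∀ b ∈ B, b < a) :
    hprod s (dgm (insert a B)) = (1 - s / (2 * a + 1)) *
      rowProd (fun k => 1 - s ^ 2 / (k : ℂ) ^ 2) B a * hprod s (dgm B) := by
  have h0 := cells_prod (fun c => 1 - s / ((hookLen (dgm (insert a B)) c : ℂ) * eps c)) a B h
  refine h0.trans ?_
  unfold hprod rowProd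
  refine congrArg₂ (· * ·) ?_ ?_
  · refine congrArg₂ (· * ·) ?_ ?_
    · simp only [hookLen, dgm_colLen, rowLen_zero a B h, eps]
      rw [show a + 1 + (a + 1) - 0 - 0 - 1 = 2 * a + 1 by omega]
      simp
    · apply Finset.prod_congr rfl
      intro j hj
      rw [Finset.mem_range] at hj
      simp only [hookLen, dgm_colLen, rowLen_zero a B h, eps, rowLen_succ a B h j hj]
      rw [show a + 1 + ((dgm B).rowLen j + 1) - 0 - (j + 1) - 1 = a - j + (dgm B).rowLen j by omega,
        show (dgm B).rowLen j + 1 + (a + 1) - (j + 1) - 0 - 1 = a - j + (dgm B).rowLen j by omega]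
      simp only [Nat.not_lt_zero, if_false, Nat.zero_lt_succ, if_true]
      generalize ((a - j + (dgm B).rowLen j : ℕ) : ℂ) = x
      rw [mul_neg, mul_one, div_neg]
      rw [← div_pow]
      ring
  · apply Finset.prod_congr rfl
    rintro ⟨i, j⟩ hc
    rw [YoungDiagram.mem_cells] at hc
    have h1 : (i + 1, j + 1) ∈ dgm (insert a B) := (mem_dgm_succ a B h i j).mpr hc
    have h2 : (i + 1, 0) ∈ dgm (insert a B) := YoungDiagram.up_left_mem _ le_rfl (Nat.zero_le _) h1
    have h3 : (0, j + 1) ∈ dgm (insert a B) := YoungDiagram.up_left_mem _ (Nat.zero_le _) le_rfl h1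
    rw [mem_dgm_zero' a B h] at h2
    rw [mem_dgm_zero a B h] at h3
    simp only [hookLen, dgm_colLen, eps, rowLen_succ a B h i (by omega),
      rowLen_succ a B h j (by omega)]
    rw [show (dgm B).rowLen i + 1 + ((dgm B).rowLen j + 1) - (i + 1) - (j + 1) - 1 =
      (dgm B).rowLen i + (dgm B).rowLen j - i - j - 1 by omega]
    simp

lemma hprod_rec (s : ℂ) (a : ℕ) (B : Finset ℕ) (h : ∀ b ∈ B, b < a) :
    hprod s (dgm (insert a B)) * ∏ b ∈ B, (1 - s ^ 2 / ((a : ℂ) - b) ^ 2) =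
      (1 - s / (2 * a + 1)) * (∏ h ∈ Finset.range a, (1 - s ^ 2 / ((h : ℂ) + 1) ^ 2)) *
      (∏ b ∈ B, (1 - s ^ 2 / ((a : ℂ) + b + 1) ^ 2)) * hprod s (dgm B) := by
  have h1 := rowProd_eq (fun k => 1 - s ^ 2 / (k : ℂ) ^ 2) B a h
  have h2 : ∏ b ∈ B, (1 - s ^ 2 / ((a - b : ℕ) : ℂ) ^ 2) =
      ∏ b ∈ B, (1 - s ^ 2 / ((a : ℂ) - b) ^ 2) := by
    apply Finset.prod_congr rfl
    intro b hb
    rw [Nat.cast_sub (h b hb).le]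
  simp only [h2] at h1
  push_cast at h1
  rw [hprod_insert s a B h]
  linear_combination (1 - s / (2 * a + 1)) * hprod s (dgm B) * h1

lemma hprod_eq_minor {s : ℂ} (hs : ∀ k : ℤ, s ≠ k) (A : Finset ℕ) :
    minor (arrN s) A = hprod s (dgm A) := by
  induction A using Finset.induction_on_max with
  | empty => rw [minor_empty, hprod, dgm_empty_cells]; simp
  | insert a B h ih =>
    have ha : a ∉ B := fun h' => lt_irrefl _ (h a h')
    have h1 := minor_arrN_insert hs a B ha
    have h2 := hprod_rec s a B h
    have h3 : ∏ b ∈ B, (1 - s ^ 2 / ((a : ℂ) - b) ^ 2) ≠ 0 := by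
      rw [Finset.prod_ne_zero_iff]
      intro b hb h0
      have hab : (a : ℂ) - b ≠ 0 := by
        rw [sub_ne_zero]; intro h'; apply ha; rw [Nat.cast_inj.mp h']; exact hb
      rw [sub_eq_zero, eq_div_iff (pow_ne_zero 2 hab), one_mul, sq_eq_sq_iff_eq_or_eq_neg] at h0
      rcases h0 with h0 | h0
      · apply hs (a - b); push_cast; exact h0.symm
      · apply hs (b - a); push_cast; linear_combination h0
    apply mul_right_cancel₀ h3
    rw [h1, h2, ih]

end COMB

section PS

lemma ps_t2 : T2Space (PowerSeries ℂ) := PowerSeries.WithPiTopology.instT2Space ℂ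

lemma ps_tendsto {ι : Type*} {f : ι → PowerSeries ℂ} {u : Filter ι} {g : PowerSeries ℂ}
    (h : ∀ d : ℕ, ∀ᶠ i in u, coeff d (f i) = coeff d g) : Filter.Tendsto f u (nhds g) := by
  refine (PowerSeries.WithPiTopology.tendsto_iff_coeff_tendsto ℂ f u g).mpr fun d => ?_
  exact Filter.Tendsto.congr' ((h d).mono fun i hi => hi.symm) tendsto_const_nhds

/-- Sum of a family, each coefficient being finitely supported. -/
lemma ps_tsum {ι : Type*} (f : ι → PowerSeries ℂ) (S : ℕ → Finset ι)
    (h : ∀ d, ∀ i ∉ S d, coeff d (f i) = 0) (d : ℕ) :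
    coeff d (∑' i, f i) = ∑ i ∈ S d, coeff d (f i) := by
  classical
  have := ps_t2
  have key : HasSum f (PowerSeries.mk fun d => ∑ i ∈ S d, coeff d (f i)) := by
    refine ps_tendsto fun d => ?_
    filter_upwards [Filter.eventually_ge_atTop (S d)] with T hT
    rw [map_sum, PowerSeries.coeff_mk]
    exact (Finset.sum_subset hT fun i _ hi => h d i hi).symm
  rw [key.tsum_eq, PowerSeries.coeff_mk]

/-- Reduction modulo `X ^ n`. -/
def qm (n : ℕ) : PowerSeries ℂ →+* PowerSeries ℂ ⧸ Ideal.span {(X : PowerSeries ℂ) ^ n} :=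
  Ideal.Quotient.mk _

lemma qm_eq_iff {n : ℕ} {f g : PowerSeries ℂ} :
    qm n f = qm n g ↔ ∀ i < n, coeff i f = coeff i g := by
  rw [qm, Ideal.Quotient.eq, Ideal.mem_span_singleton, PowerSeries.X_pow_dvd_iff]
  simp only [map_sub, sub_eq_zero]

lemma qm_zero_iff {n : ℕ} {f : PowerSeries ℂ} : qm n f = 0 ↔ ∀ i < n, coeff i f = 0 := by
  have := qm_eq_iff (n := n) (f := f) (g := 0)
  simpa using this

lemma qm_X_pow {n m : ℕ} (h : n ≤ m) : qm n (X ^ m) = 0 := by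
  rw [qm_zero_iff]
  intro i hi
  rw [PowerSeries.coeff_X_pow, if_neg (by omega)]

lemma qm_pow_zero {n k : ℕ} {f : PowerSeries ℂ} (hf : PowerSeries.constantCoeff f = 0)
    (h : n ≤ k) : qm n (f ^ k) = 0 := by
  obtain ⟨g, rfl⟩ := PowerSeries.X_dvd_iff.mpr hf
  rw [mul_pow, map_mul, qm_X_pow h, zero_mul]

/-- Infinite product of a family of factors tending to one. -/
lemma ps_tprod (f : ℕ → PowerSeries ℂ) (h : ∀ k n, n ≤ k + 1 → qm n (f k) = 1) (n : ℕ) :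
    qm n (∏' i, f i) = qm n (∏ i ∈ Finset.range n, f i) := by
  classical
  have := ps_t2
  have h1 : ∀ n (T : Finset ℕ), Finset.range n ⊆ T →
      qm n (∏ i ∈ T, f i) = qm n (∏ i ∈ Finset.range n, f i) := by
    intro n T hT
    rw [map_prod, map_prod]
    symm
    apply Finset.prod_subset hT
    intro i _ hi
    rw [Finset.mem_range] at hi
    exact h i n (by omega)
  have key : HasProd f (PowerSeries.mk fun d => coeff d (∏ i ∈ Finset.range (d + 1), f i)) := by
    refine ps_tendsto fun d => ?_
    filter_upwards [Filter.eventually_ge_atTop (Finset.range (d + 1))] with T hT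
    rw [PowerSeries.coeff_mk]
    exact qm_eq_iff.mp (h1 (d + 1) T hT) d (by omega)
  rw [key.tprod_eq, qm_eq_iff]
  intro d hd
  rw [PowerSeries.coeff_mk]
  refine (qm_eq_iff.mp (h1 (d + 1) (Finset.range n) ?_) d (by omega)).symm
  intro i; simp only [Finset.mem_range]; omega

lemma coeff_cpow {f : PowerSeries ℂ} (hf : PowerSeries.constantCoeff f = 1) (z : ℂ) {d n : ℕ}
    (hd : d < n) :
    coeff d (cpow f z) = ∑ k ∈ Finset.range n, cchoose z k * coeff d ((f - 1) ^ k) := by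
  have h0 : PowerSeries.constantCoeff (f - 1) = 0 := by rw [map_sub, hf, map_one, sub_self]
  have hz : ∀ d k, d < k → coeff d ((f - 1) ^ k) = 0 := fun d k hk =>
    qm_zero_iff.mp (qm_pow_zero h0 le_rfl) d hk
  rw [cpow, ps_tsum _ (fun d => Finset.range (d + 1))]
  · simp only [PowerSeries.coeff_C_mul]
    apply Finset.sum_subset
    · intro i; simp only [Finset.mem_range]; omega
    · intro i _ hi
      rw [Finset.mem_range] at hi
      rw [hz d i (by omega), mul_zero]
  · intro d i hi
    rw [Finset.mem_range] at hi
    rw [PowerSeries.coeff_C_mul, hz d i (by omega), mul_zero]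

lemma cchoose_nat (m k : ℕ) : cchoose (m : ℂ) k = (m.choose k : ℂ) := by
  rw [cchoose, div_eq_iff (by exact_mod_cast Nat.factorial_ne_zero k)]
  rw [← Nat.cast_mul, mul_comm, ← Nat.descFactorial_eq_factorial_mul_choose]
  induction k with
  | zero => simp
  | succ k ih =>
    rw [Finset.prod_range_succ, ih, Nat.descFactorial_succ]
    rcases le_or_gt k m with h | h
    · push_cast [Nat.cast_sub h]; ring
    · rw [Nat.descFactorial_of_lt h]; simp

lemma cpow_nat {f : PowerSeries ℂ} (hf : PowerSeries.constantCoeff f = 1) (m : ℕ) :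
    cpow f (m : ℂ) = f ^ m := by
  ext d
  rw [coeff_cpow hf (m : ℂ) (show d < d + m + 1 by omega)]
  conv_rhs => rw [show f = (f - 1) + 1 by ring, add_pow]
  rw [map_sum]
  symm
  apply Finset.sum_subset_zero_on_sdiff
  · intro i; simp only [Finset.mem_range]; omega
  · intro k hk
    simp only [Finset.mem_sdiff, Finset.mem_range] at hk
    rw [cchoose_nat, Nat.choose_eq_zero_of_lt (by omega)]; simp
  · intro k _
    rw [cchoose_nat, one_pow, mul_one, mul_comm, ← map_natCast (PowerSeries.C (R := ℂ)),
      PowerSeries.coeff_C_mul]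

lemma constantCoeff_cpow {f : PowerSeries ℂ} (hf : PowerSeries.constantCoeff f = 1) (z : ℂ) :
    PowerSeries.constantCoeff (cpow f z) = 1 := by
  rw [← PowerSeries.coeff_zero_eq_constantCoeff_apply, coeff_cpow hf z Nat.zero_lt_one]
  simp [cchoose]

/-- Families of power series whose coefficients are polynomial in the parameter. -/
def PC (F : ℂ → PowerSeries ℂ) : Prop :=
  ∀ i, ∃ p : Polynomial ℂ, ∀ z, coeff i (F z) = p.eval z

/-- Polynomial functions. -/
def PF (f : ℂ → ℂ) : Prop := ∃ p : Polynomial ℂ, ∀ z, f z = p.eval z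

lemma PF.const (c : ℂ) : PF fun _ => c := ⟨Polynomial.C c, by simp⟩
lemma PF.id : PF fun z => z := ⟨Polynomial.X, by simp⟩
lemma PF.add {f g : ℂ → ℂ} (hf : PF f) (hg : PF g) : PF fun z => f z + g z := by
  obtain ⟨p, hp⟩ := hf; obtain ⟨q, hq⟩ := hg
  exact ⟨p + q, fun z => by rw [Polynomial.eval_add, ← hp, ← hq]⟩
lemma PF.mul {f g : ℂ → ℂ} (hf : PF f) (hg : PF g) : PF fun z => f z * g z := by
  obtain ⟨p, hp⟩ := hf; obtain ⟨q, hq⟩ := hg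
  exact ⟨p * q, fun z => by rw [Polynomial.eval_mul, ← hp, ← hq]⟩
lemma PF.sub {f g : ℂ → ℂ} (hf : PF f) (hg : PF g) : PF fun z => f z - g z := by
  obtain ⟨p, hp⟩ := hf; obtain ⟨q, hq⟩ := hg
  exact ⟨p - q, fun z => by rw [Polynomial.eval_sub, ← hp, ← hq]⟩
lemma PF.div_const {f : ℂ → ℂ} (hf : PF f) (c : ℂ) : PF fun z => f z / c := by
  simp only [div_eq_mul_inv]
  exact hf.mul (PF.const _)
lemma PF.comp {f g : ℂ → ℂ} (hf : PF f) (hg : PF g) : PF fun z => f (g z) := by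
  obtain ⟨p, hp⟩ := hf; obtain ⟨q, hq⟩ := hg
  exact ⟨p.comp q, fun z => by rw [Polynomial.eval_comp, ← hp, ← hq]⟩
lemma PF.sum {ι : Type*} (s : Finset ι) {f : ι → ℂ → ℂ} (hf : ∀ i ∈ s, PF (f i)) :
    PF fun z => ∑ i ∈ s, f i z := by
  classical
  induction s using Finset.induction_on with
  | empty => simpa using PF.const 0
  | insert a s ha ih =>
    simp only [Finset.sum_insert ha]
    exact (hf a (Finset.mem_insert_self _ _)).add
      (ih fun i hi => hf i (Finset.mem_insert_of_mem hi))
lemma PF.prod {ι : Type*} (s : Finset ι) {f : ι → ℂ → ℂ} (hf : ∀ i ∈ s, PF (f i)) :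
    PF fun z => ∏ i ∈ s, f i z := by
  classical
  induction s using Finset.induction_on with
  | empty => simpa using PF.const 1
  | insert a s ha ih =>
    simp only [Finset.prod_insert ha]
    exact (hf a (Finset.mem_insert_self _ _)).mul
      (ih fun i hi => hf i (Finset.mem_insert_of_mem hi))

lemma PC.coeff {F : ℂ → PowerSeries ℂ} (h : PC F) (i : ℕ) : PF fun z => coeff i (F z) := h i
lemma PC.of {F : ℂ → PowerSeries ℂ} (h : ∀ i, PF fun z => PowerSeries.coeff i (F z)) : PC F := h
lemma PC.const (c : PowerSeries ℂ) : PC fun _ => c := fun _ => PF.const _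
lemma PC.sub {F G : ℂ → PowerSeries ℂ} (hF : PC F) (hG : PC G) : PC fun z => F z - G z := by
  intro i
  simp only [map_sub]
  exact (hF.coeff i).sub (hG.coeff i)
lemma PC.mul {F G : ℂ → PowerSeries ℂ} (hF : PC F) (hG : PC G) : PC fun z => F z * G z := by
  intro i
  simp only [PowerSeries.coeff_mul]
  exact PF.sum _ fun p _ => (hF.coeff p.1).mul (hG.coeff p.2)
lemma PC.pow {F : ℂ → PowerSeries ℂ} (hF : PC F) (k : ℕ) : PC fun z => F z ^ k := by
  induction k with
  | zero => simpa using PC.const 1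
  | succ k ih => simp only [pow_succ]; exact ih.mul hF
lemma PC.prod {ι : Type*} (s : Finset ι) {F : ι → ℂ → PowerSeries ℂ} (hF : ∀ i ∈ s, PC (F i)) :
    PC fun z => ∏ i ∈ s, F i z := by
  classical
  induction s using Finset.induction_on with
  | empty => simpa using PC.const 1
  | insert a s ha ih =>
    simp only [Finset.prod_insert ha]
    exact (hF a (Finset.mem_insert_self _ _)).mul
      (ih fun i hi => hF i (Finset.mem_insert_of_mem hi))
lemma PC.sum {ι : Type*} (s : Finset ι) {F : ι → ℂ → PowerSeries ℂ} (hF : ∀ i ∈ s, PC (F i)) :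
    PC fun z => ∑ i ∈ s, F i z := by
  intro d
  simp only [map_sum]
  exact PF.sum _ fun i hi => (hF i hi).coeff d
lemma PC.C {f : ℂ → ℂ} (hf : PF f) : PC fun z => PowerSeries.C (f z) := by
  intro i
  simp only [PowerSeries.coeff_C]
  split_ifs
  · exact hf
  · exact PF.const 0

lemma PF.cchoose (k : ℕ) : PF fun z => cchoose z k := by
  unfold _root_.cchoose
  exact (PF.prod _ fun i _ => PF.id.sub (PF.const _)).div_const _

lemma PC.cpow {F : ℂ → PowerSeries ℂ} (hF : PC F) (h1 : ∀ z, PowerSeries.constantCoeff (F z) = 1)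
    {f : ℂ → ℂ} (hf : PF f) : PC fun z => cpow (F z) (f z) := by
  intro i
  simp only [coeff_cpow (h1 _) _ (Nat.lt_succ_self i)]
  exact PF.sum _ fun k _ => ((PF.cchoose k).comp hf).mul (((hF.sub (PC.const 1)).pow k).coeff i)

/-- Interpolation. -/
lemma PF.ext {f g : ℂ → ℂ} (hf : PF f) (hg : PF g) {S : Set ℂ} (hS : S.Infinite)
    (h : ∀ z ∈ S, f z = g z) (z : ℂ) : f z = g z := by
  obtain ⟨p, hp⟩ := hf; obtain ⟨q, hq⟩ := hg
  have : p = q := by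
    apply Polynomial.eq_of_infinite_eval_eq
    apply hS.mono
    intro z hz
    change p.eval z = q.eval z
    rw [← hp, ← hq, h z hz]
  rw [hp, hq, this]

lemma PC.ext {F G : ℂ → PowerSeries ℂ} (hF : PC F) (hG : PC G) {S : Set ℂ} (hS : S.Infinite)
    {n : ℕ} (h : ∀ z ∈ S, qm n (F z) = qm n (G z)) (z : ℂ) : qm n (F z) = qm n (G z) := by
  rw [qm_eq_iff]
  intro i hi
  exact (hF.coeff i).ext (hG.coeff i) hS (fun z hz => qm_eq_iff.mp (h z hz) i hi) z

end PS

section FIN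

lemma arrPa_map {K L : Type*} [CommRing K] [CommRing L] (φ : K →+* L) (N : ℕ → ℕ → K) (a b : ℕ) :
    arrPa (fun a b => φ (N a b)) a b = φ (arrPa N a b) := by
  cases a <;> simp [arrPa]

lemma arrPb_map {K L : Type*} [CommRing K] [CommRing L] (φ : K →+* L) (N : ℕ → ℕ → K) (a b : ℕ) :
    arrPb (fun a b => φ (N a b)) a b = φ (arrPb N a b) := by
  cases b <;> simp [arrPb]

lemma arrD_map {K L : Type*} [CommRing K] [CommRing L] (φ : K →+* L) (a b : ℕ) :
    (arrD a b : L) = φ (arrD a b) := by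
  unfold arrD
  split_ifs <;> simp

lemma Riccati_map {K L : Type*} [CommRing K] [CommRing L] (φ : K →+* L) {N : ℕ → ℕ → K}
    (h : Riccati N) : Riccati (fun a b => φ (N a b)) := by
  intro a b
  rw [arrPa_map, arrPb_map, arrD_map φ, ← map_mul, ← h a b]
  simp only [map_add, map_sub]

lemma shiftArr_map {K L : Type*} [CommRing K] [CommRing L] (φ : K →+* L) (N : ℕ → ℕ → K) :
    (fun a b => φ (shiftArr 1 N a b)) = shiftArr 1 (fun a b => φ (N a b)) := by
  apply shiftArr_unique
  intro a b
  rw [arrPa_map, arrPb_map, arrD_map φ]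
  have := congrArg φ (shiftArr_spec 1 N a b)
  simpa only [map_sub, map_mul, map_one] using this

/-- Truncated generating function of self-conjugate partitions. -/
def Zf (n : ℕ) (s : ℂ) : PowerSeries ℂ :=
  ∑ A ∈ (Finset.range n).powerset,
    PowerSeries.C ((-1) ^ A.card * hprod s (dgm A)) * X ^ (∑ a ∈ A, (2 * a + 1))

/-- Truncated product of `1 + X ^ k`. -/
def Pf (n : ℕ) : PowerSeries ℂ :=
  ∏ j ∈ Finset.range n, ((1 + X ^ (2 * j + 1)) * (1 + X ^ (2 * j + 2)))

/-- Truncated product of `1 - X ^ k` over even `k`. -/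
def Ef (n : ℕ) : PowerSeries ℂ := ∏ j ∈ Finset.range n, (1 - X ^ (2 * j + 2))

/-- Truncated product of `1 - X ^ k` over odd `k`. -/
def Of (n : ℕ) : PowerSeries ℂ := ∏ j ∈ Finset.range n, (1 - X ^ (2 * j + 1))

/-- Truncated binomial factors. -/
def Bf (n : ℕ) (s : ℂ) : PowerSeries ℂ :=
  ∏ j ∈ Finset.range n, ∑ k ∈ Finset.range n, PowerSeries.C (pcc (-s) k) * (X ^ (2 * j + 2)) ^ k

lemma gz_Zf (n : ℕ) {s : ℂ} (hs : ∀ k : ℤ, s ≠ k) :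
    gz n (qm n X) (fun a b => (qm n).comp PowerSeries.C (arrN s a b)) = qm n (Zf n s) := by
  rw [gz_expand, Zf, map_sum]
  apply Finset.sum_congr rfl
  intro A _
  rw [minor_map, hprod_eq_minor hs]
  simp only [map_mul, map_pow, map_neg, map_one, RingHom.comp_apply]
  ring

lemma Zf_step_generic (n : ℕ) {s : ℂ} (hs : ∀ k : ℤ, s ≠ k) :
    qm n (Zf n (s + 1)) = qm n (Pf n * Bf n s * Zf n s) := by
  have hs1 : ∀ k : ℤ, s + 1 ≠ k := by
    intro k hk
    apply hs (k - 1)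
    push_cast
    rw [← hk]; ring
  have h := gz_final (n := n) (qm n X) (by rw [← map_pow, qm_X_pow le_rfl]) _
    (Riccati_map ((qm n).comp PowerSeries.C) (arrN_E2 hs))
    (fun k => (qm n).comp PowerSeries.C (pcc (-s) k)) (by simp only [pcc_zero, map_one])
    (fun a => by simp only [arrN_E3 hs, map_add])
  rw [← shiftArr_map, ← arrN_E1 hs, gz_Zf n hs1, gz_Zf n hs] at h
  rw [h, Pf, Bf, ← Finset.prod_mul_distrib]
  simp only [map_mul, map_prod, map_sum, map_add, map_pow, map_one, RingHom.comp_apply]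

lemma PF_pcc (k : ℕ) : PF fun s => pcc (-s) k := by
  unfold pcc
  refine PF.prod _ fun i _ => PF.div_const ?_ _
  have : PF fun s : ℂ => 0 - s + i := ((PF.const 0).sub PF.id).add (PF.const _)
  simpa using this

lemma PF_hprod (μ : YoungDiagram) : PF fun s => hprod s μ := by
  unfold hprod
  exact PF.prod _ fun i _ => (PF.const 1).sub (PF.id.div_const _)

lemma PC_Zf (n : ℕ) : PC (Zf n) := by
  unfold Zf
  exact PC.sum _ fun A _ => (PC.C ((PF.const _).mul (PF_hprod _))).mul (PC.const _)

lemma PC_Bf (n : ℕ) : PC (Bf n) := by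
  unfold Bf
  exact PC.prod _ fun j _ => PC.sum _ fun k _ => (PC.C (PF_pcc k)).mul (PC.const _)

lemma PC_comp {F : ℂ → PowerSeries ℂ} (hF : PC F) {f : ℂ → ℂ} (hf : PF f) :
    PC fun z => F (f z) := fun i => PF.comp (hF.coeff i) hf

lemma nonint_infinite : {s : ℂ | ∀ k : ℤ, s ≠ k}.Infinite := by
  have h : (Set.range fun k : ℤ => (k : ℂ)).Countable := Set.countable_range _
  have h2 : {s : ℂ | ∀ k : ℤ, s ≠ k} = (Set.range fun k : ℤ => (k : ℂ))ᶜ := by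
    ext s
    simp [eq_comm]
  rw [h2]
  intro hfin
  have := hfin.countable.union h
  rw [Set.compl_union_self] at this
  exact not_countable_complex this

lemma Zf_step (n : ℕ) (s : ℂ) : qm n (Zf n (s + 1)) = qm n (Pf n * Bf n s * Zf n s) :=
  PC.ext (F := fun s => Zf n (s + 1)) (G := fun s => Pf n * Bf n s * Zf n s)
    (PC_comp (PC_Zf n) (PF.id.add (PF.const 1)))
    (((PC.const _).mul (PC_Bf n)).mul (PC_Zf n)) nonint_infinite
    (fun _ hz => Zf_step_generic n hz) s

lemma pcc_nat (m k : ℕ) : pcc (-(m : ℂ)) k = (-1) ^ k * (m.choose k : ℂ) := by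
  induction k with
  | zero => simp [pcc_zero]
  | succ k ih =>
    rw [pcc_succ, ih]
    have h : (k : ℂ) + 1 ≠ 0 := by exact_mod_cast Nat.succ_ne_zero k
    have h2 : (m.choose (k + 1) : ℂ) * (k + 1) = m.choose k * (m - k) := by
      rcases le_or_gt k m with hk | hk
      · have := Nat.choose_succ_right_eq m k
        rw [← Nat.cast_sub hk]
        exact_mod_cast this
      · rw [Nat.choose_eq_zero_of_lt hk, Nat.choose_eq_zero_of_lt (by omega)]; simp
    rw [mul_div_assoc', div_eq_iff h]
    linear_combination (-1) ^ k * h2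

lemma Bf_nat (n m : ℕ) : qm n (Bf n m) = qm n (Ef n ^ m) := by
  rw [Bf, Ef, ← Finset.prod_pow, map_prod, map_prod]
  apply Finset.prod_congr rfl
  intro j _
  set v : PowerSeries ℂ := X ^ (2 * j + 2) with hv
  have h1 : (1 - v) ^ m = ∑ k ∈ Finset.range (m + 1), PowerSeries.C (pcc (-(m : ℂ)) k) * v ^ k := by
    rw [sub_eq_neg_add, add_pow]
    apply Finset.sum_congr rfl
    intro k _
    rw [pcc_nat, neg_pow]
    simp only [map_mul, map_pow, map_neg, map_one, map_natCast, one_pow]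
    ring
  have h2 : ∑ k ∈ Finset.range (m + 1), PowerSeries.C (pcc (-(m : ℂ)) k) * v ^ k =
      ∑ k ∈ Finset.range (m + 1 + n), PowerSeries.C (pcc (-(m : ℂ)) k) * v ^ k := by
    apply Finset.sum_subset
    · intro i; simp only [Finset.mem_range]; omega
    · intro i _ hi
      rw [Finset.mem_range] at hi
      rw [pcc_nat, Nat.choose_eq_zero_of_lt (by omega)]
      simp
  rw [h1, h2, map_sum, map_sum]
  apply Finset.sum_subset
  · intro i; simp only [Finset.mem_range]; omega
  · intro i _ hi
    rw [Finset.mem_range] at hi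
    rw [map_mul, hv, ← pow_mul, qm_X_pow, mul_zero]
    nlinarith

lemma Zf_zero (n : ℕ) : Zf n 0 = Of n := by
  rw [Zf, Of]
  simp only [sub_eq_add_neg]
  rw [Finset.prod_one_add]
  apply Finset.sum_congr rfl
  intro A _
  rw [Finset.prod_neg, Finset.prod_pow_eq_pow_sum]
  simp [hprod]

lemma Zf_nat (n m : ℕ) : qm n (Zf n m) = qm n (Of n * Pf n ^ m * Ef n ^ (m.choose 2)) := by
  induction m with
  | zero => simp [Zf_zero]
  | succ m ih =>
    rw [Nat.cast_succ, Zf_step, map_mul, map_mul, ih, Bf_nat, ← map_mul, ← map_mul,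
      Nat.choose_succ_succ' m 1, Nat.choose_one_right]
    congr 1
    ring

/-- Truncated full product. -/
def Df (n : ℕ) : PowerSeries ℂ := ∏ j ∈ Finset.range n, (1 - X ^ (j + 1))

lemma Of_mul_Ef (n : ℕ) : Of n * Ef n = Df (2 * n) := by
  induction n with
  | zero => simp [Of, Ef, Df]
  | succ n ih =>
    rw [show 2 * (n + 1) = 2 * n + 1 + 1 by ring]
    unfold Of Ef Df at *
    rw [Finset.prod_range_succ, Finset.prod_range_succ, Finset.prod_range_succ,
      Finset.prod_range_succ, ← ih]
    ring

lemma Pf_eq (n : ℕ) : Pf n = ∏ j ∈ Finset.range (2 * n), (1 + X ^ (j + 1)) := by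
  induction n with
  | zero => simp [Pf]
  | succ n ih =>
    rw [show 2 * (n + 1) = 2 * n + 1 + 1 by ring]
    unfold Pf at *
    rw [Finset.prod_range_succ, Finset.prod_range_succ, Finset.prod_range_succ, ← ih]
    ring

lemma Pf_mul_Df (n : ℕ) : Pf n * Df (2 * n) = Ef (2 * n) := by
  rw [Pf_eq, Df, Ef, ← Finset.prod_mul_distrib]
  apply Finset.prod_congr rfl
  intro j _
  ring

lemma qm_prod_extend (n m : ℕ) (h : n ≤ m) (f : ℕ → PowerSeries ℂ)
    (hf : ∀ k, n ≤ k → qm n (f k) = 1) :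
    qm n (∏ j ∈ Finset.range m, f j) = qm n (∏ j ∈ Finset.range n, f j) := by
  rw [map_prod, map_prod]
  symm
  apply Finset.prod_subset
  · intro i; simp only [Finset.mem_range]; omega
  · intro i _ hi
    rw [Finset.mem_range] at hi
    exact hf i (by omega)

lemma qm_one_sub {n m : ℕ} (h : n ≤ m) : qm n (1 - X ^ m) = 1 := by
  rw [map_sub, qm_X_pow h, map_one, sub_zero]

lemma qm_Df (n : ℕ) : qm n (Df (2 * n)) = qm n (Df n) :=
  qm_prod_extend n (2 * n) (by omega) _ fun k hk => qm_one_sub (by omega)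

lemma qm_Ef (n : ℕ) : qm n (Ef (2 * n)) = qm n (Ef n) :=
  qm_prod_extend n (2 * n) (by omega) _ fun k hk => qm_one_sub (by omega)

lemma cc_one_sub (k : ℕ) : PowerSeries.constantCoeff (1 - X ^ (k + 1) : PowerSeries ℂ) = 1 := by
  simp

lemma isUnit_Ef (n : ℕ) : IsUnit (Ef n) := by
  rw [PowerSeries.isUnit_iff_constantCoeff, Ef, map_prod]
  simp

lemma euler (n : ℕ) : qm n (Of n) * qm n (Pf n) = 1 := by
  have h1 : qm n (Pf n) * qm n (Df (2 * n)) = qm n (Ef n) := by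
    rw [← map_mul, Pf_mul_Df, qm_Ef]
  rw [← Of_mul_Ef, map_mul] at h1
  have h2 := (isUnit_Ef n).map (qm n)
  apply h2.mul_right_cancel
  linear_combination h1

/-- The factors of the product. -/
def fac (z : ℂ) (k : ℕ) : PowerSeries ℂ :=
  cpow (1 - X ^ (2 * (k + 1))) (z + 1) * (1 - X ^ (k + 1) : PowerSeries ℂ)⁻¹

lemma cc_one_sub' (k : ℕ) :
    PowerSeries.constantCoeff (1 - X ^ (2 * (k + 1)) : PowerSeries ℂ) = 1 := cc_one_sub (2 * k + 1)

lemma qm_inv (n k : ℕ) (h : n ≤ k + 1) : qm n ((1 - X ^ (k + 1) : PowerSeries ℂ)⁻¹) = 1 := by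
  have h1 : (1 - X ^ (k + 1) : PowerSeries ℂ) * (1 - X ^ (k + 1) : PowerSeries ℂ)⁻¹ = 1 :=
    PowerSeries.mul_inv_cancel _ (by rw [cc_one_sub]; exact one_ne_zero)
  have h2 := congrArg (qm n) h1
  rwa [map_mul, qm_one_sub h, one_mul, map_one] at h2

lemma qm_cpow (n : ℕ) {f : PowerSeries ℂ} (hf : PowerSeries.constantCoeff f = 1)
    (h : qm n f = 1) (z : ℂ) : qm n (cpow f z) = 1 := by
  rw [← map_one (qm n), qm_eq_iff]
  intro i hi
  rw [coeff_cpow hf z (Nat.lt_succ_self i), Finset.sum_range_succ']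
  rw [Finset.sum_eq_zero, zero_add]
  · simp [cchoose]
  · intro k _
    have : qm n ((f - 1) ^ (k + 1)) = 0 := by
      rw [map_pow, map_sub, h, map_one, sub_self, zero_pow (Nat.succ_ne_zero k)]
    rw [qm_zero_iff.mp this i hi, mul_zero]

lemma qm_fac (z : ℂ) (k n : ℕ) (h : n ≤ k + 1) : qm n (fac z k) = 1 := by
  rw [fac, map_mul, qm_inv n k h, mul_one]
  exact qm_cpow n (cc_one_sub' k) (qm_one_sub (by omega)) _

lemma qm_tprod_fac (z : ℂ) (n : ℕ) :
    qm n (∏' k, fac z k) = qm n (∏ k ∈ Finset.range n, fac z k) :=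
  ps_tprod _ (qm_fac z) n

lemma PC_fac (k : ℕ) : PC fun z => fac z k := by
  unfold fac
  exact (PC.cpow (PC.const _) (fun _ => cc_one_sub' k) (PF.id.add (PF.const 1))).mul (PC.const _)

lemma PC_tprod_fac : PC fun z => ∏' k, fac z k := by
  refine PC.of fun i => ?_
  have h : (fun z => coeff i (∏' k, fac z k)) =
      fun z => coeff i (∏ k ∈ Finset.range (i + 1), fac z k) := by
    funext z
    exact qm_eq_iff.mp (qm_tprod_fac z (i + 1)) i (by omega)
  rw [h]
  exact (PC.prod _ fun k _ => PC_fac k).coeff i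

lemma cc_tprod_fac (z : ℂ) : PowerSeries.constantCoeff (∏' k, fac z k) = 1 := by
  rw [← PowerSeries.coeff_zero_eq_constantCoeff_apply,
    qm_eq_iff.mp (qm_tprod_fac z 1) 0 Nat.zero_lt_one, Finset.prod_range_one]
  have := qm_eq_iff.mp ((qm_fac z 0 1 le_rfl).trans (map_one (qm 1)).symm) 0 Nat.zero_lt_one
  rw [this, PowerSeries.coeff_zero_one]

lemma PC_lhs : PC fun z => cpow (∏' k, fac z k) (2 * z - 1) :=
  PC_tprod_fac.cpow cc_tprod_fac (((PF.const 2).mul PF.id).sub (PF.const 1))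

lemma lhs_nat (n u : ℕ) :
    qm n (cpow (∏' k, fac ((u + 1 : ℕ) : ℂ) k) (2 * ((u + 1 : ℕ) : ℂ) - 1)) =
      qm n (Zf n (2 * ((u + 1 : ℕ) : ℂ))) := by
  rw [show 2 * ((u + 1 : ℕ) : ℂ) - 1 = ((2 * u + 1 : ℕ) : ℂ) by push_cast; ring,
    show 2 * ((u + 1 : ℕ) : ℂ) = ((2 * u + 2 : ℕ) : ℂ) by push_cast; ring,
    cpow_nat (cc_tprod_fac _), Zf_nat, map_pow, qm_tprod_fac]
  have h1 : ∏ k ∈ Finset.range n, fac ((u + 1 : ℕ) : ℂ) k = Ef n ^ (u + 2) *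
      ∏ k ∈ Finset.range n, (1 - X ^ (k + 1) : PowerSeries ℂ)⁻¹ := by
    unfold fac Ef
    rw [← Finset.prod_pow, ← Finset.prod_mul_distrib]
    apply Finset.prod_congr rfl
    intro k _
    rw [show ((u + 1 : ℕ) : ℂ) + 1 = ((u + 2 : ℕ) : ℂ) by push_cast; ring,
      cpow_nat (cc_one_sub' k)]
    rfl
  have h2 : Df n * ∏ k ∈ Finset.range n, (1 - X ^ (k + 1) : PowerSeries ℂ)⁻¹ = 1 := by
    rw [Df, ← Finset.prod_mul_distrib]
    apply Finset.prod_eq_one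
    intro k _
    exact PowerSeries.mul_inv_cancel _ (by rw [cc_one_sub]; exact one_ne_zero)
  have h3 := congrArg (qm n) h2
  rw [map_mul, ← qm_Df, ← Of_mul_Ef, map_mul, map_one] at h3
  rw [h1]
  simp only [map_mul, map_pow]
  have h4 := euler n
  have h5 : (2 * u + 2).choose 2 = (u + 1) * (2 * u + 1) := by
    rw [Nat.choose_two_right]
    apply Nat.div_eq_of_eq_mul_left (by norm_num)
    rw [show 2 * u + 2 - 1 = 2 * u + 1 by omega]
    ring
  rw [h5]
  generalize qm n (∏ k ∈ Finset.range n, (1 - X ^ (k + 1) : PowerSeries ℂ)⁻¹) = d at *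
  generalize qm n (Of n) = o at *
  generalize qm n (Ef n) = e at *
  generalize qm n (Pf n) = p at *
  have h6 : e * d = p := by linear_combination p * h3 - e * d * h4
  have h7 : e ^ (u + 2) * d = e ^ (u + 1) * p := by rw [← h6]; ring
  rw [h7, mul_pow, ← pow_mul]
  rw [show o * p ^ (2 * u + 2) = (o * p) * p ^ (2 * u + 1) by ring, h4]
  ring

lemma lhs_eq (n : ℕ) (z : ℂ) :
    qm n (cpow (∏' k, fac z k) (2 * z - 1)) = qm n (Zf n (2 * z)) := by
  refine PC.ext (F := fun z => cpow (∏' k, fac z k) (2 * z - 1)) (G := fun z => Zf n (2 * z))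
    PC_lhs (PC_comp (PC_Zf n) ((PF.const 2).mul PF.id))
    (S := Set.range fun u : ℕ => ((u + 1 : ℕ) : ℂ)) ?_ ?_ z
  · apply Set.infinite_range_of_injective
    intro a b h
    have := Nat.cast_injective h
    omega
  · rintro _ ⟨u, rfl⟩
    exact lhs_nat n u

/-- Self-conjugate diagrams and finite sets. -/
def scEquiv : Finset ℕ ≃ {μ : YoungDiagram // μ.transpose = μ} :=
  Equiv.ofBijective (fun A => ⟨dgm A, dgm_transpose A⟩)
    ⟨fun A B h => dgm_injective (congrArg Subtype.val h),
      fun μ => by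
        obtain ⟨A, hA⟩ := dgm_surjective μ.1 μ.2
        exact ⟨A, Subtype.ext hA⟩⟩

lemma rhs_eq (z : ℂ) (d : ℕ) :
    coeff d (∑' μ : {μ : YoungDiagram // μ.transpose = μ},
      PowerSeries.C ((-1) ^ durfee μ.1 *
        ∏ c ∈ μ.1.cells, (1 - 2 * z / ((hookLen μ.1 c : ℂ) * eps c))) * X ^ μ.1.card) =
      coeff d (Zf (d + 1) (2 * z)) := by
  rw [← scEquiv.tsum_eq, ps_tsum _ (fun d => (Finset.range (d + 1)).powerset), Zf, map_sum]
  · apply Finset.sum_congr rfl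
    intro A _
    change coeff d (PowerSeries.C ((-1) ^ durfee (dgm A) * hprod (2 * z) (dgm A)) *
      X ^ (dgm A).card) = _
    rw [dgm_durfee, dgm_card]
  · intro d A hA
    change coeff d (PowerSeries.C ((-1) ^ durfee (dgm A) * hprod (2 * z) (dgm A)) *
      X ^ (dgm A).card) = _
    rw [PowerSeries.coeff_C_mul, PowerSeries.coeff_X_pow, if_neg, mul_zero]
    rw [dgm_card]
    intro h
    apply hA
    rw [Finset.mem_powerset]
    intro a ha
    rw [Finset.mem_range]
    have := Finset.single_le_sum (f := fun a => 2 * a + 1) (fun _ _ => Nat.zero_le _) ha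
    omega

end FIN

theorem nekrasov_okounkov_type_C_check (z : ℂ) :
    cpow (∏' k : ℕ, cpow (1 - X ^ (2 * (k + 1))) (z + 1) *
        (1 - X ^ (k + 1) : PowerSeries ℂ)⁻¹) (2 * z - 1)
      =
    ∑' μ : {μ : YoungDiagram // μ.transpose = μ},
      PowerSeries.C ((-1) ^ durfee μ.1 *
        ∏ c ∈ μ.1.cells, (1 - 2 * z / ((hookLen μ.1 c : ℂ) * eps c))) * X ^ μ.1.card := by
  ext d
  rw [rhs_eq]
  exact qm_eq_iff.mp (lhs_eq (d + 1) z) d (by omega)
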